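/- arXiv:2311.00963 — 3 statements merged into one kernel-verified Lean document; each statement's English description precedes it below -/
import Mathlib

section
/- Let d ≥ 3 and k be integers with 1 ≤ k ≤ d-2 and 2k + 3 > d. Let a_k, ..., a_{d-2} and b_0, ..., b_{d-1} be complex numbers with a_k ≠ 0 and b_0 ≠ 0, and let f be the bivariate polynomial f(x,y) = x·( Σ_{i=k}^{d-2} a_i x^i y^{d-2-i} + Σ_{j=0}^{d-1} b_j x^j y^{d-1-j} ). Assume f is square-free. Then lct₀(f) = (2k+1)/(kd+1). -/
open MeasureTheory MvPolynomial

/-- The log canonical threshold at the origin of a function `f : ℂ × ℂ → ℂ`,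
defined via the complex singularity exponent. -/
noncomputable def lct₀ (f : ℂ × ℂ → ℂ) : ℝ :=
  sSup { c : ℝ | 0 ≤ c ∧ ∃ ε : ℝ, 0 < ε ∧
    IntegrableOn (fun p : ℂ × ℂ => ‖f p‖ ^ (-2 * c)) (Metric.ball (0 : ℂ × ℂ) ε) volume }

/-- Evaluation of a bivariate polynomial as a function on `ℂ × ℂ`. -/
noncomputable def evalFun (f : MvPolynomial (Fin 2) ℂ) : ℂ × ℂ → ℂ :=
  fun p => MvPolynomial.eval ![p.1, p.2] f

theorem lintegral_comp_div_complex (F : ℂ → ENNReal) {z : ℂ} (hz : z ≠ 0) :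
    ∫⁻ y, F (y / z) = ENNReal.ofReal (‖z‖ ^ 2) * ∫⁻ y, F y := by
  have hdet : LinearMap.det (LinearMap.mulLeft ℝ z⁻¹) = (‖z‖ ^ 2)⁻¹ := by
    have h := Algebra.norm_complex_apply z⁻¹
    rw [Algebra.norm_apply] at h
    rw [← inv_pow, ← norm_inv, ← Complex.normSq_eq_norm_sq, ← h]
    rfl
  have hpos : 0 < ‖z‖ ^ 2 := by positivity
  have hmap := Measure.map_linearMap_addHaar_eq_smul_addHaar (volume : Measure ℂ)
    (f := LinearMap.mulLeft ℝ z⁻¹) (by rw [hdet]; positivity)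
  rw [hdet, inv_inv, abs_of_pos hpos] at hmap
  have hemb : MeasurableEmbedding (fun y : ℂ => z⁻¹ * y) :=
    (Homeomorph.mulLeft₀ z⁻¹ (inv_ne_zero hz)).measurableEmbedding
  rw [← smul_eq_mul, ← lintegral_smul_measure, ← hmap]
  have := hemb.lintegral_map (μ := volume) F
  simp only [div_eq_inv_mul]
  exact this.symm

theorem integrableOn_ball_norm_rpow {p : ℝ} (hp : p < 2) {ρ : ℝ} (hρ : 0 < ρ) :
    IntegrableOn (fun w : ℂ => ‖w‖ ^ (-p)) (Metric.ball 0 ρ) := by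
  rw [integrableOn_fun_norm_addHaar (f := fun y : ℝ => y ^ (-p)) volume]
  have h := (intervalIntegral.integrableOn_Ioo_rpow_iff (s := 1 - p) hρ).2 (by linarith)
  refine h.congr_fun (fun y hy => ?_) measurableSet_Ioo
  simp [sub_eq_add_neg, Real.rpow_add hy.1]

theorem integrable_norm_rpow_piecewise {p q : ℝ} (hp : p < 2) (hq : 2 < q) :
    Integrable (fun w : ℂ => if ‖w‖ ≤ 1 then ‖w‖ ^ (-p) else ‖w‖ ^ (-q)) := by
  rw [integrable_fun_norm_addHaar (f := fun y : ℝ => if y ≤ 1 then y ^ (-p) else y ^ (-q)) volume,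
    ← Set.Ioc_union_Ioi_eq_Ioi zero_le_one, integrableOn_union]
  constructor
  · have h := (intervalIntegral.integrableOn_Ioo_rpow_iff (s := 1 - p) one_pos).2 (by linarith)
    refine ((integrableOn_Ioc_iff_integrableOn_Ioo).2 h).congr_fun (fun y hy => ?_) measurableSet_Ioc
    simp [sub_eq_add_neg, Real.rpow_add hy.1, hy.2]
  · have h := integrableOn_Ioi_rpow_of_lt (a := 1 - q) (by linarith) one_pos
    refine h.congr_fun (fun y hy => ?_) measurableSet_Ioi
    have hy' : (1 : ℝ) < y := hy
    simp [sub_eq_add_neg, Real.rpow_add (one_pos.trans hy'), hy']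

theorem norm_prod_sub_rpow_le {N M : ℕ} (hN : 0 < N) {e δ : ℝ} (he : 0 < e) (hδ : 0 < δ)
    (hδ1 : δ ≤ 1) (r : Fin N → ℂ)
    (hsep : ∀ s : Finset (Fin N), M < s.card → ∃ i ∈ s, ∃ j ∈ s, 2 * δ ≤ ‖r i - r j‖) (v : ℂ) :
    ‖∏ i, (v - r i)‖ ^ (-e) ≤ ∑ i, (δ ^ N) ^ (-e) *
      (if ‖v - r i‖ ≤ 1 then ‖v - r i‖ ^ (-(e * M)) else ‖v - r i‖ ^ (-(e * N))) := by
  have : Nonempty (Fin N) := ⟨⟨0, hN⟩⟩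
  have hnonneg : ∀ i, 0 ≤ (δ ^ N) ^ (-e) *
      (if ‖v - r i‖ ≤ 1 then ‖v - r i‖ ^ (-(e * M)) else ‖v - r i‖ ^ (-(e * N))) := by
    intro i; split_ifs <;> positivity
  obtain ⟨i₀, -, hi₀⟩ := Finset.exists_min_image Finset.univ (fun i => ‖v - r i‖)
    Finset.univ_nonempty
  refine le_trans ?_ (Finset.single_le_sum (fun i _ => hnonneg i) (Finset.mem_univ i₀))
  set l := ‖v - r i₀‖ with hl
  rcases (norm_nonneg (v - r i₀)).eq_or_lt with h0 | hpos
  · have : ∏ i, (v - r i) = 0 :=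
      Finset.prod_eq_zero (Finset.mem_univ i₀) (norm_eq_zero.1 h0.symm)
    rw [this, norm_zero, Real.zero_rpow (by linarith)]
    exact hnonneg i₀
  have hlow : ∀ m : ℕ, δ ^ N * l ^ m ≤ ‖∏ i, (v - r i)‖ →
      ‖∏ i, (v - r i)‖ ^ (-e) ≤ (δ ^ N) ^ (-e) * l ^ (-(e * m)) := by
    intro m hm
    calc _ ≤ (δ ^ N * l ^ m) ^ (-e) :=
          Real.rpow_le_rpow_of_nonpos (by positivity) hm (by linarith)
      _ = _ := by
          rw [Real.mul_rpow (by positivity) (by positivity), ← Real.rpow_natCast l m,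
            ← Real.rpow_mul hpos.le, mul_neg, mul_comm (m : ℝ)]
  split_ifs with h1
  · apply hlow
    classical
    set s := Finset.univ.filter fun i => ‖v - r i‖ < δ with hs
    have hcard : s.card ≤ M := by
      by_contra! hlt
      obtain ⟨i, hi, j, hj, hij⟩ := hsep s hlt
      simp only [hs, Finset.mem_filter, Finset.mem_univ, true_and] at hi hj
      have : ‖r i - r j‖ ≤ ‖v - r j‖ + ‖v - r i‖ := by
        simpa using norm_sub_le (v - r j) (v - r i)
      linarith
    rw [norm_prod, ← Finset.prod_filter_mul_prod_filter_not Finset.univ fun i => ‖v - r i‖ < δ,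
      mul_comm]
    refine mul_le_mul ?_ ?_ (by positivity) (by positivity)
    · calc l ^ M ≤ l ^ s.card := pow_le_pow_of_le_one hpos.le h1 hcard
        _ = ∏ i ∈ s, l := by simp
        _ ≤ _ := Finset.prod_le_prod (fun _ _ => hpos.le) fun i _ => hi₀ i (Finset.mem_univ i)
    · set u := Finset.univ.filter fun i => ¬ ‖v - r i‖ < δ with hu
      calc δ ^ N ≤ δ ^ u.card := pow_le_pow_of_le_one hδ.le hδ1 (by simpa using u.card_le_univ)
        _ = ∏ i ∈ u, δ := by simp
        _ ≤ _ := Finset.prod_le_prod (fun _ _ => hδ.le) fun i hi => by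
            simpa [hu] using hi
  · apply hlow
    rw [norm_prod]
    calc δ ^ N * l ^ N ≤ 1 * l ^ N := by
          gcongr; exact pow_le_one₀ hδ.le hδ1
      _ = ∏ _i : Fin N, l := by simp
      _ ≤ _ := Finset.prod_le_prod (fun _ _ => hpos.le) fun i _ => hi₀ i (Finset.mem_univ i)

theorem exists_root_separation {N M : ℕ} (p : ℂ → Polynomial ℂ)
    (hcont : ∀ n, Continuous fun t => (p t).coeff n) (hmonic : ∀ t, (p t).Monic)
    (hdeg : ∀ t, (p t).natDegree = N) (hmult : ∀ w, (p 0).rootMultiplicity w ≤ M) :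
    ∃ δ : ℝ, 0 < δ ∧ δ ≤ 1 ∧ ∀ t, ‖t‖ ≤ δ → ∀ r : Fin N → ℂ,
      p t = ∏ i, (Polynomial.X - Polynomial.C (r i)) →
      ∀ s : Finset (Fin N), M < s.card → ∃ i ∈ s, ∃ j ∈ s, 2 * δ ≤ ‖r i - r j‖ := by
  have heval : Continuous fun q : ℂ × ℂ => (p q.1).eval q.2 := by
    have : (fun q : ℂ × ℂ => (p q.1).eval q.2) =
        fun q => ∑ n ∈ Finset.range (N + 1), (p q.1).coeff n * q.2 ^ n := by
      ext q
      rw [Polynomial.eval_eq_sum_range, hdeg]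
    rw [this]
    have h := fun n => (hcont n).comp (continuous_fst (X := ℂ) (Y := ℂ))
    exact continuous_finsetSum _ fun n _ => (h n).mul (continuous_snd.pow n)
  set K : Set (ℂ × (Fin N → ℂ)) :=
    {q | ‖q.1‖ ≤ 1 ∧ ∀ v, (p q.1).eval v = ∏ i, (v - q.2 i)} with hK
  have hclosed : IsClosed K := by
    rw [hK, Set.ofPred_and, Set.ofPred_forall]
    refine (isClosed_le (by fun_prop) (by fun_prop)).inter (isClosed_iInter fun v => ?_)
    exact isClosed_eq (heval.comp (by fun_prop : Continuous fun q : ℂ × (Fin N → ℂ) => (q.1, v)))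
      (by fun_prop)
  obtain ⟨B, hB⟩ : ∃ B : ℝ, ∀ q ∈ K, ∀ i, ‖q.2 i‖ ≤ B := by
    have hbd : ∀ n, ∃ A : ℝ, ∀ t : ℂ, ‖t‖ ≤ 1 → ‖(p t).coeff n‖ ≤ A := fun n => by
      obtain ⟨A, hA⟩ := (isCompact_closedBall (0 : ℂ) 1).exists_bound_of_continuousOn
        (hcont n).continuousOn
      exact ⟨A, fun t ht => hA t (by simpa using ht)⟩
    choose A hA using hbd
    refine ⟨(∑ n ∈ Finset.range N, A n) + 1, fun q hq i => ?_⟩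
    have hroot : (p q.1).IsRoot (q.2 i) := by
      rw [Polynomial.IsRoot, hq.2]
      exact Finset.prod_eq_zero (Finset.mem_univ i) (sub_self _)
    have h := hroot.norm_lt_cauchyBound (hmonic _).ne_zero
    rw [Polynomial.cauchyBound, (hmonic _).leadingCoeff, hdeg, nnnorm_one, div_one] at h
    refine (NNReal.coe_lt_coe.2 h).le.trans ?_
    rw [NNReal.coe_add, NNReal.coe_one]
    gcongr
    have hle : (Finset.range N).sup (fun n => ‖(p q.1).coeff n‖₊) ≤
        ∑ n ∈ Finset.range N, ‖(p q.1).coeff n‖₊ :=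
      Finset.sup_le fun n hn => Finset.single_le_sum (f := fun n => ‖(p q.1).coeff n‖₊)
        (fun _ _ => zero_le) hn
    refine (NNReal.coe_le_coe.2 hle).trans ?_
    rw [NNReal.coe_sum]
    exact Finset.sum_le_sum fun n _ => hA n _ hq.1
  have hcompact : IsCompact K := by
    refine Metric.isCompact_of_isClosed_isBounded hclosed
      ((Metric.isBounded_closedBall (x := 0) (r := max 1 (max B 0))).subset fun q hq => ?_)
    rw [mem_closedBall_zero_iff, Prod.norm_def]
    exact max_le_max hq.1 ((pi_norm_le_iff_of_nonneg (le_max_right _ _)).2 fun i =>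
      (hB q hq i).trans (le_max_left _ _))
  have hev : ∀ s : Finset (Fin N), ∀ᶠ δ : ℝ in nhdsWithin 0 (Set.Ioi 0), ∀ t, ‖t‖ ≤ δ → ‖t‖ ≤ 1 →
      ∀ r : Fin N → ℂ, p t = ∏ i, (Polynomial.X - Polynomial.C (r i)) →
      M < s.card → ∃ i ∈ s, ∃ j ∈ s, 2 * δ ≤ ‖r i - r j‖ := by
    intro s
    by_cases hs : M < s.card
    swap
    · exact Filter.Eventually.of_forall fun _ _ _ _ _ _ h => absurd h hs
    obtain ⟨ε, hε, hεK⟩ := hcompact.exists_forall_le' (a := 0)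
      (f := fun q : ℂ × (Fin N → ℂ) => ‖q.1‖ + ∑ i ∈ s, ∑ j ∈ s, ‖q.2 i - q.2 j‖)
      (Continuous.continuousOn (by fun_prop)) (by
        intro q hq
        have hnn : 0 ≤ ∑ i ∈ s, ∑ j ∈ s, ‖q.2 i - q.2 j‖ := by positivity
        by_contra! hle
        have h1 : q.1 = 0 := norm_eq_zero.1 (le_antisymm (by linarith) (norm_nonneg _))
        have h2 : ∑ i ∈ s, ∑ j ∈ s, ‖q.2 i - q.2 j‖ = 0 :=
          le_antisymm (by linarith [norm_nonneg q.1]) hnn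
        rw [Finset.sum_eq_zero_iff_of_nonneg (fun _ _ => by positivity)] at h2
        obtain ⟨i₀, hi₀⟩ := Finset.card_pos.1 (M.zero_le.trans_lt hs)
        have h3 := (Finset.sum_eq_zero_iff_of_nonneg (fun _ _ => norm_nonneg _)).1 (h2 i₀ hi₀)
        have hp : p 0 = ∏ i, (Polynomial.X - Polynomial.C (q.2 i)) := by
          refine Polynomial.funext fun v => ?_
          rw [← h1, hq.2, Polynomial.eval_prod]
          simp
        have hdvd : (Polynomial.X - Polynomial.C (q.2 i₀)) ^ s.card ∣ p 0 := by
          rw [hp, ← Finset.prod_const]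
          refine (Finset.prod_congr rfl fun j hj => ?_).dvd.trans
            (Finset.prod_dvd_prod_of_subset s Finset.univ _ s.subset_univ)
          rw [sub_eq_zero.1 (norm_eq_zero.1 (h3 j hj))]
        have := (Polynomial.le_rootMultiplicity_iff (hmonic 0).ne_zero).2 hdvd
        have := hmult (q.2 i₀)
        omega)
    have hlim : ∀ᶠ δ : ℝ in nhdsWithin 0 (Set.Ioi 0), δ + s.card * (s.card * (2 * δ)) < ε := by
      refine nhdsWithin_le_nhds ?_
      refine (Continuous.tendsto (by fun_prop :
        Continuous fun δ : ℝ => δ + s.card * (s.card * (2 * δ))) 0).eventually_lt_const ?_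
      simpa using hε
    filter_upwards [hlim] with δ hδ t ht ht1 r hr _
    by_contra! hcon
    have hmem : (t, r) ∈ K := ⟨ht1, fun v => by
      show (p t).eval v = _
      rw [hr, Polynomial.eval_prod]; simp⟩
    have h := hεK _ hmem
    have h2 : ∑ i ∈ s, ∑ j ∈ s, ‖r i - r j‖ ≤ s.card * (s.card * (2 * δ)) := by
      calc _ ≤ ∑ i ∈ s, ∑ j ∈ s, 2 * δ :=
            Finset.sum_le_sum fun i hi => Finset.sum_le_sum fun j hj => (hcon i hi j hj).le
        _ = _ := by simp
    simp only at h
    linarith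
  obtain ⟨δ, h, hδ, hδ1⟩ := ((Filter.eventually_all.2 hev).and
    ((eventually_mem_nhdsWithin).and
      (nhdsWithin_le_nhds (Iic_mem_nhds (zero_lt_one (α := ℝ)))))).exists
  exact ⟨δ, hδ, hδ1, fun t ht r hr s hs => h s t ht (ht.trans hδ1) r hr hs⟩

theorem exists_eq_prod_X_sub_C {N : ℕ} {p : Polynomial ℂ} (hp : p.Monic) (hdeg : p.natDegree = N) :
    ∃ r : Fin N → ℂ, p = ∏ i, (Polynomial.X - Polynomial.C (r i)) := by
  have hcard : p.roots.toList.length = N := by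
    rw [Multiset.length_toList, ← hdeg, (IsAlgClosed.splits p).natDegree_eq_card_roots]
  subst hcard
  refine ⟨fun i => p.roots.toList.get i, ?_⟩
  conv_lhs => rw [(IsAlgClosed.splits p).eq_prod_roots_of_monic hp, ← Multiset.coe_toList p.roots,
    Multiset.map_coe, Multiset.prod_coe]
  rw [← List.prod_ofFn]
  congr 1
  apply List.ext_get <;> simp

theorem exists_lintegral_eval_rpow_le {N M : ℕ} (hN : 0 < N) (p : ℂ → Polynomial ℂ)
    (hcont : ∀ n, Continuous fun t => (p t).coeff n) (hmonic : ∀ t, (p t).Monic)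
    (hdeg : ∀ t, (p t).natDegree = N) (hmult : ∀ w, (p 0).rootMultiplicity w ≤ M)
    {e : ℝ} (he : 0 < e) (heM : e * M < 2) (heN : 2 < e * N) :
    ∃ δ : ℝ, 0 < δ ∧ ∃ A : ENNReal, A ≠ ⊤ ∧ ∀ t, ‖t‖ ≤ δ →
      ∫⁻ v, ENNReal.ofReal (‖(p t).eval v‖ ^ (-e)) ≤ A := by
  obtain ⟨δ, hδ, hδ1, hsep⟩ := exists_root_separation p hcont hmonic hdeg hmult
  set g : ℂ → ℝ := fun w => (δ ^ N) ^ (-e) *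
    (if ‖w‖ ≤ 1 then ‖w‖ ^ (-(e * M)) else ‖w‖ ^ (-(e * N))) with hg
  have hgint : Integrable g := (integrable_norm_rpow_piecewise heM heN).const_mul _
  have hg0 : ∀ w, 0 ≤ g w := fun w => by
    simp only [hg]
    split_ifs <;> positivity
  refine ⟨δ, hδ, N * ∫⁻ w, ENNReal.ofReal (g w), ?_, fun t ht => ?_⟩
  · exact ENNReal.mul_ne_top (by simp) hgint.lintegral_lt_top.ne
  obtain ⟨r, hr⟩ := exists_eq_prod_X_sub_C (hmonic t) (hdeg t)
  calc ∫⁻ v, ENNReal.ofReal (‖(p t).eval v‖ ^ (-e))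
      ≤ ∫⁻ v, ∑ i : Fin N, ENNReal.ofReal (g (v - r i)) := by
        refine lintegral_mono fun v => ?_
        rw [← ENNReal.ofReal_sum_of_nonneg fun i _ => hg0 _]
        refine ENNReal.ofReal_le_ofReal ?_
        have h := norm_prod_sub_rpow_le hN he hδ hδ1 r (hsep t ht r hr) v
        rw [hr, Polynomial.eval_prod]
        simpa only [Polynomial.eval_sub, Polynomial.eval_X, Polynomial.eval_C] using h
    _ = ∑ i : Fin N, ∫⁻ v, ENNReal.ofReal (g (v - r i)) := by
        refine lintegral_finsetSum' _ fun i _ => ?_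
        exact (hgint.comp_sub_right (r i)).aestronglyMeasurable.aemeasurable.ennreal_ofReal
    _ = _ := by
        simp only [lintegral_sub_right_eq_self (fun w => ENNReal.ofReal (g w))]
        simp

/-- The function `F` with `f (t ^ (k + 1) * u, t ^ k * v) = t ^ (k * d + 1) * F t u v`. -/
noncomputable def weightedTransform (a b : ℕ → ℂ) (d k : ℕ) (t u v : ℂ) : ℂ :=
  u * ((∑ i ∈ Finset.Icc k (d - 2), a i * t ^ (i - k) * u ^ i * v ^ (d - 2 - i)) +
    ∑ j ∈ Finset.range d, b j * t ^ j * u ^ j * v ^ (d - 1 - j))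

/-- The monic polynomial in `v` proportional to `weightedTransform a b d k t 1 v`. -/
noncomputable def weightedFiber (a b : ℕ → ℂ) (d k : ℕ) (t : ℂ) : Polynomial ℂ :=
  Polynomial.C (b 0)⁻¹ *
    ((∑ i ∈ Finset.Icc k (d - 2), Polynomial.C (a i * t ^ (i - k)) * Polynomial.X ^ (d - 2 - i)) +
      ∑ j ∈ Finset.range d, Polynomial.C (b j * t ^ j) * Polynomial.X ^ (d - 1 - j))

section Weighted

variable {a b : ℕ → ℂ} {d k : ℕ}

theorem weightedTransform_one (hb : b 0 ≠ 0) (t v : ℂ) :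
    weightedTransform a b d k t 1 v = b 0 * (weightedFiber a b d k t).eval v := by
  simp [weightedTransform, weightedFiber, Polynomial.eval_finsetSum, mul_inv_cancel_left₀ hb]

theorem evalFun_weighted (hd : 3 ≤ d) (hkd : k ≤ d - 2) {f : MvPolynomial (Fin 2) ℂ}
    (hf : f = X 0 *
      ((∑ i ∈ Finset.Icc k (d - 2), C (a i) * X 0 ^ i * X 1 ^ (d - 2 - i)) +
        ∑ j ∈ Finset.range d, C (b j) * X 0 ^ j * X 1 ^ (d - 1 - j))) (t u v : ℂ) :
    evalFun f (t ^ (k + 1) * u, t ^ k * v) =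
      t ^ (k * d + 1) * weightedTransform a b d k t u v := by
  have h1 : t ^ (k * (d - 1)) *
      (∑ i ∈ Finset.Icc k (d - 2), a i * t ^ (i - k) * u ^ i * v ^ (d - 2 - i)) =
      ∑ i ∈ Finset.Icc k (d - 2), a i * (t ^ (k + 1) * u) ^ i * (t ^ k * v) ^ (d - 2 - i) := by
    rw [Finset.mul_sum]
    refine Finset.sum_congr rfl fun i hi => ?_
    obtain ⟨hi1, hi2⟩ := Finset.mem_Icc.1 hi
    obtain ⟨n, rfl⟩ := Nat.exists_eq_add_of_le hi1
    obtain ⟨m, hm⟩ := Nat.exists_eq_add_of_le hi2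
    rw [show d - 1 = k + n + m + 1 by omega, hm, Nat.add_sub_cancel_left, Nat.add_sub_cancel_left]
    ring
  have h2 : t ^ (k * (d - 1)) *
      (∑ j ∈ Finset.range d, b j * t ^ j * u ^ j * v ^ (d - 1 - j)) =
      ∑ j ∈ Finset.range d, b j * (t ^ (k + 1) * u) ^ j * (t ^ k * v) ^ (d - 1 - j) := by
    rw [Finset.mul_sum]
    refine Finset.sum_congr rfl fun j hj => ?_
    obtain ⟨m, hm⟩ := Nat.exists_eq_add_of_le (Nat.le_sub_one_of_lt (Finset.mem_range.1 hj))
    rw [hm, Nat.add_sub_cancel_left]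
    ring
  have h3 : t ^ (k * d + 1) = t ^ (k + 1) * t ^ (k * (d - 1)) := by
    obtain ⟨n, rfl⟩ := Nat.exists_eq_add_of_le' (show 1 ≤ d by omega)
    rw [Nat.add_sub_cancel]
    ring
  simp only [hf, evalFun, weightedTransform, map_mul, map_add, map_sum, map_pow, eval_X, eval_C,
    Matrix.cons_val_zero, Matrix.cons_val_one]
  rw [← h1, ← h2, h3]
  ring

theorem continuous_weightedFiber_coeff (n : ℕ) :
    Continuous fun t => (weightedFiber a b d k t).coeff n := by
  simp only [weightedFiber, Polynomial.coeff_C_mul, Polynomial.coeff_add,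
    Polynomial.finsetSum_coeff]
  fun_prop

theorem natDegree_weightedFiber_le (t : ℂ) : (weightedFiber a b d k t).natDegree ≤ d - 1 := by
  refine (Polynomial.natDegree_C_mul_le _ _).trans
    (Polynomial.natDegree_add_le_of_degree_le ?_ ?_) <;>
  refine Polynomial.natDegree_sum_le_of_forall_le _ _ fun i _ =>
    (Polynomial.natDegree_C_mul_X_pow_le _ _).trans (by omega)

theorem weightedFiber_coeff (hd : 3 ≤ d) (hb : b 0 ≠ 0) (t : ℂ) :
    (weightedFiber a b d k t).coeff (d - 1) = 1 := by
  simp only [weightedFiber, Polynomial.coeff_C_mul, Polynomial.coeff_add,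
    Polynomial.finsetSum_coeff, Polynomial.coeff_X_pow]
  rw [Finset.sum_eq_zero fun i _ => by rw [if_neg (by omega), mul_zero],
    Finset.sum_eq_single_of_mem 0 (by simp; omega)
      fun j hj hj0 => by rw [if_neg (by simp at hj; omega), mul_zero]]
  simp [hb]

theorem monic_weightedFiber (hd : 3 ≤ d) (hb : b 0 ≠ 0) (t : ℂ) :
    (weightedFiber a b d k t).Monic :=
  Polynomial.monic_of_natDegree_le_of_coeff_eq_one _ (natDegree_weightedFiber_le t)
    (weightedFiber_coeff hd hb t)

theorem natDegree_weightedFiber (hd : 3 ≤ d) (hb : b 0 ≠ 0) (t : ℂ) :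
    (weightedFiber a b d k t).natDegree = d - 1 :=
  Polynomial.natDegree_eq_of_le_of_coeff_ne_zero (natDegree_weightedFiber_le t)
    (by rw [weightedFiber_coeff hd hb]; exact one_ne_zero)

theorem weightedFiber_zero (hd : 3 ≤ d) (hkd : k ≤ d - 2) (hb : b 0 ≠ 0) :
    weightedFiber a b d k 0 = Polynomial.X ^ (d - 2 - k) *
      (Polynomial.X ^ (k + 1) + Polynomial.C ((b 0)⁻¹ * a k)) := by
  rw [weightedFiber, Finset.sum_eq_single_of_mem k (by simp [hkd])
      fun i hi hik => by
        rw [zero_pow (by have := (Finset.mem_Icc.1 hi).1; omega), mul_zero, map_zero, zero_mul],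
    Finset.sum_eq_single_of_mem 0 (by simp; omega)
      fun j hj hj0 => by rw [zero_pow hj0, mul_zero, map_zero, zero_mul]]
  have h1 : (Polynomial.C (b 0)⁻¹ * Polynomial.C (b 0) : Polynomial ℂ) = 1 := by
    rw [← map_mul, inv_mul_cancel₀ hb, map_one]
  rw [show d - 1 - 0 = d - 2 - k + (k + 1) by omega, pow_add Polynomial.X (d - 2 - k)]
  simp only [Nat.sub_self, pow_zero, mul_one, map_mul]
  linear_combination (Polynomial.X ^ (d - 2 - k) * Polynomial.X ^ (k + 1)) * h1

theorem rootMultiplicity_weightedFiber_zero_le (hd : 3 ≤ d) (hkd : k ≤ d - 2) (ha : a k ≠ 0)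
    (hb : b 0 ≠ 0) (w : ℂ) :
    (weightedFiber a b d k 0).rootMultiplicity w ≤ max (d - 2 - k) 1 := by
  have hne := (monic_weightedFiber (a := a) (k := k) hd hb 0).ne_zero
  rw [weightedFiber_zero hd hkd hb] at hne ⊢
  have hne2 := right_ne_zero_of_mul hne
  rw [Polynomial.rootMultiplicity_mul hne]
  by_cases hw : w = 0
  · subst hw
    have h0 : (Polynomial.X ^ (k + 1) + Polynomial.C ((b 0)⁻¹ * a k)).rootMultiplicity 0 = 0 :=
      Polynomial.rootMultiplicity_eq_zero (by simp [ha, hb])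
    have h1 := Polynomial.rootMultiplicity_X_sub_C_pow (0 : ℂ) (d - 2 - k)
    rw [map_zero, sub_zero] at h1
    rw [h0, h1]
    simp
  · have h0 : (Polynomial.X ^ (d - 2 - k)).rootMultiplicity w = 0 :=
      Polynomial.rootMultiplicity_eq_zero (by simp [hw])
    rw [h0, zero_add]
    refine le_trans ?_ (le_max_right _ _)
    by_contra! hlt
    have h := ((Polynomial.one_lt_rootMultiplicity_iff_isRoot hne2).1 hlt).2
    simp [hw] at h
    norm_cast at h

end Weighted

section Threshold

variable {a b : ℕ → ℂ} {d k : ℕ} {f : MvPolynomial (Fin 2) ℂ}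

theorem measurable_norm_evalFun_rpow (f : MvPolynomial (Fin 2) ℂ) (e : ℝ) :
    Measurable fun p : ℂ × ℂ => ‖evalFun f p‖ ^ e := by
  have hcont : Continuous (evalFun f) := by
    refine (MvPolynomial.continuous_eval f).comp (continuous_pi fun i => ?_)
    fin_cases i <;> simp <;> fun_prop
  exact (hcont.norm.measurable).pow_const e

theorem norm_rpow_weight {T x : ℝ} (hT : 0 < T) (hTx : T ^ (k + 1) = x) (e : ℝ) :
    T ^ (2 * k) * (T ^ (k * d + 1)) ^ (-e) =
      x ^ (-((e * (k * d + 1) - 2 * k) / (k + 1))) := by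
  rw [← hTx, ← Real.rpow_natCast, ← Real.rpow_natCast, ← Real.rpow_natCast, ← Real.rpow_mul hT.le,
    ← Real.rpow_mul hT.le, ← Real.rpow_add hT]
  congr 1
  have : (k : ℝ) + 1 ≠ 0 := by positivity
  push_cast
  field_simp
  ring

theorem exists_lintegral_fiber_le (hd : 3 ≤ d) (hkd : k ≤ d - 2) (ha : a k ≠ 0) (hb : b 0 ≠ 0)
    (hf : f = X 0 *
      ((∑ i ∈ Finset.Icc k (d - 2), C (a i) * X 0 ^ i * X 1 ^ (d - 2 - i)) +
        ∑ j ∈ Finset.range d, C (b j) * X 0 ^ j * X 1 ^ (d - 1 - j)))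
    {e : ℝ} (he : 0 < e) (heM : e * (max (d - 2 - k) 1 : ℕ) < 2) (heN : 2 < e * (d - 1 : ℕ)) :
    ∃ ρ : ℝ, 0 < ρ ∧ ∃ A : ENNReal, A ≠ ⊤ ∧ ∀ x : ℂ, ‖x‖ < ρ →
      ∫⁻ y, ENNReal.ofReal (‖evalFun f (x, y)‖ ^ (-e)) ≤
        A * ENNReal.ofReal (‖x‖ ^ (-((e * (k * d + 1) - 2 * k) / (k + 1)))) := by
  obtain ⟨δ, hδ, A, hA, hint⟩ := exists_lintegral_eval_rpow_le (by omega)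
    (weightedFiber a b d k) continuous_weightedFiber_coeff (monic_weightedFiber hd hb)
    (natDegree_weightedFiber hd hb) (rootMultiplicity_weightedFiber_zero_le hd hkd ha hb)
    he heM heN
  refine ⟨δ ^ (k + 1), by positivity, ENNReal.ofReal (‖b 0‖ ^ (-e)) * A,
    ENNReal.mul_ne_top ENNReal.ofReal_ne_top hA, fun x hx => ?_⟩
  rcases eq_or_ne x 0 with rfl | hx0
  · have h0 : ∀ y, evalFun f (0, y) = 0 := fun y => by simp [evalFun, hf]
    simp [h0, Real.zero_rpow (neg_ne_zero.2 he.ne')]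
  obtain ⟨t, rfl⟩ := IsAlgClosed.exists_pow_nat_eq x k.succ_pos
  have ht0 : t ≠ 0 := fun h => hx0 (by simp [h])
  have htδ : ‖t‖ ≤ δ := by
    rw [norm_pow] at hx
    exact (lt_of_pow_lt_pow_left₀ _ hδ.le hx).le
  have htpos : 0 < ‖t‖ := norm_pos_iff.2 ht0
  have hfib : ∀ y, ENNReal.ofReal (‖evalFun f (t ^ (k + 1), y)‖ ^ (-e)) =
      ENNReal.ofReal ((‖t‖ ^ (k * d + 1)) ^ (-e) * ‖b 0‖ ^ (-e)) *
        ENNReal.ofReal (‖(weightedFiber a b d k t).eval (y / t ^ k)‖ ^ (-e)) := fun y => by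
    have h := evalFun_weighted hd hkd hf t 1 (y / t ^ k)
    rw [mul_one, mul_div_cancel₀ _ (pow_ne_zero k ht0), weightedTransform_one hb] at h
    rw [h, norm_mul, norm_mul, norm_pow, Real.mul_rpow (by positivity) (by positivity),
      Real.mul_rpow (by positivity) (by positivity), ← mul_assoc, ENNReal.ofReal_mul (by positivity)]
  calc ∫⁻ y, ENNReal.ofReal (‖evalFun f (t ^ (k + 1), y)‖ ^ (-e))
      = ENNReal.ofReal ((‖t‖ ^ (k * d + 1)) ^ (-e) * ‖b 0‖ ^ (-e)) *
          (ENNReal.ofReal (‖t ^ k‖ ^ 2) *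
            ∫⁻ v, ENNReal.ofReal (‖(weightedFiber a b d k t).eval v‖ ^ (-e))) := by
        simp only [hfib]
        rw [lintegral_const_mul' _ _ ENNReal.ofReal_ne_top,
          lintegral_comp_div_complex
            (fun v => ENNReal.ofReal (‖(weightedFiber a b d k t).eval v‖ ^ (-e)))
            (pow_ne_zero k ht0)]
    _ ≤ ENNReal.ofReal ((‖t‖ ^ (k * d + 1)) ^ (-e) * ‖b 0‖ ^ (-e)) *
          (ENNReal.ofReal (‖t ^ k‖ ^ 2) * A) := by
        gcongr
        exact hint t htδ
    _ = _ := by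
        rw [← norm_rpow_weight (d := d) htpos (norm_pow t (k + 1)).symm e,
          ENNReal.ofReal_mul (by positivity), ENNReal.ofReal_mul (by positivity), norm_pow,
          ← pow_mul, mul_comm k 2]
        ring

theorem integrableOn_ball_of_lt (hd : 3 ≤ d) (hkd : k ≤ d - 2) (ha : a k ≠ 0) (hb : b 0 ≠ 0)
    (hf : f = X 0 *
      ((∑ i ∈ Finset.Icc k (d - 2), C (a i) * X 0 ^ i * X 1 ^ (d - 2 - i)) +
        ∑ j ∈ Finset.range d, C (b j) * X 0 ^ j * X 1 ^ (d - 1 - j)))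
    {e : ℝ} (he : 0 < e) (heM : e * (max (d - 2 - k) 1 : ℕ) < 2) (heN : 2 < e * (d - 1 : ℕ))
    (hlt : e * (k * d + 1) < 2 * (2 * k + 1)) :
    ∃ ρ : ℝ, 0 < ρ ∧ IntegrableOn (fun p : ℂ × ℂ => ‖evalFun f p‖ ^ (-e))
      (Metric.ball (0 : ℂ × ℂ) ρ) volume := by
  obtain ⟨ρ, hρ, A, hA, hle⟩ := exists_lintegral_fiber_le hd hkd ha hb hf he heM heN
  have hmeas := measurable_norm_evalFun_rpow f (-e)
  refine ⟨ρ, hρ, hmeas.aestronglyMeasurable, ?_⟩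
  rw [hasFiniteIntegral_iff_ofReal (Filter.Eventually.of_forall fun _ => by positivity)]
  set q : ℝ := (e * (k * d + 1) - 2 * k) / (k + 1) with hq
  have hq2 : q < 2 := by
    rw [hq, div_lt_iff₀ (by positivity)]
    linarith
  have hball : Metric.ball (0 : ℂ × ℂ) ρ = Metric.ball 0 ρ ×ˢ Metric.ball 0 ρ := by
    rw [ball_prod_same]; rfl
  rw [hball, Measure.volume_eq_prod, ← Measure.prod_restrict,
    lintegral_prod _ hmeas.ennreal_ofReal.aemeasurable]
  calc _ ≤ ∫⁻ x in Metric.ball (0 : ℂ) ρ, A * ENNReal.ofReal (‖x‖ ^ (-q)) := by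
        refine setLIntegral_mono' measurableSet_ball fun x hx => ?_
        exact (setLIntegral_le_lintegral _ _).trans (hle x (by simpa using hx))
    _ = A * ∫⁻ x in Metric.ball (0 : ℂ) ρ, ENNReal.ofReal (‖x‖ ^ (-q)) :=
        lintegral_const_mul' _ _ hA
    _ < ⊤ := ENNReal.mul_lt_top hA.lt_top (integrableOn_ball_norm_rpow hq2 hρ).lintegral_lt_top

theorem volume_ball_prod_ball (x y : ℂ) {r s : ℝ} (hr : 0 ≤ r) (hs : 0 ≤ s) :
    volume (Metric.ball x r ×ˢ Metric.ball y s) =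
      ENNReal.ofReal ((r * s) ^ 2 * Real.pi ^ 2) := by
  rw [Measure.volume_eq_prod, Measure.prod_prod, Complex.volume_ball, Complex.volume_ball,
    ← ENNReal.ofReal_coe_nnreal, NNReal.coe_real_pi, ← ENNReal.ofReal_pow hr,
    ← ENNReal.ofReal_pow hs, ← ENNReal.ofReal_mul (by positivity),
    ← ENNReal.ofReal_mul (by positivity), ← ENNReal.ofReal_mul (by positivity)]
  congr 1
  ring

theorem continuous_weightedTransform :
    Continuous fun q : ℂ × ℂ × ℂ => weightedTransform a b d k q.1 q.2.1 q.2.2 := by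
  unfold weightedTransform
  fun_prop

theorem exists_weightedTransform_bounds (hd : 3 ≤ d) (hb : b 0 ≠ 0) :
    ∃ v₀ : ℂ, ∃ η : ℝ, 0 < η ∧ ∃ B : ℝ, 0 < B ∧ ∀ t u v : ℂ, ‖t‖ < η → ‖u - 1‖ < η →
      ‖v - v₀‖ < η → weightedTransform a b d k t u v ≠ 0 ∧ ‖weightedTransform a b d k t u v‖ ≤ B := by
  obtain ⟨v₀, hv₀⟩ : ∃ v, (weightedFiber a b d k 0).eval v ≠ 0 := by
    by_contra! h
    exact (monic_weightedFiber hd hb 0).ne_zero (Polynomial.funext (by simpa using h))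
  have h0 : weightedTransform a b d k 0 1 v₀ ≠ 0 := by
    rw [weightedTransform_one hb]
    exact mul_ne_zero hb hv₀
  have hc := (continuous_weightedTransform (a := a) (b := b) (d := d) (k := k)).continuousAt
    (x := (0, 1, v₀))
  have hev := (hc.eventually_ne h0).and
    (hc.norm.eventually_lt_const (lt_add_one ‖weightedTransform a b d k 0 1 v₀‖))
  obtain ⟨η, hη, h⟩ := Metric.eventually_nhds_iff.1 hev
  refine ⟨v₀, η, hη, ‖weightedTransform a b d k 0 1 v₀‖ + 1, by positivity, fun t u v ht hu hv => ?_⟩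
  have := h (y := (t, u, v)) (by
    rw [Prod.dist_eq, Prod.dist_eq, dist_eq_norm, dist_eq_norm, dist_eq_norm, sub_zero]
    exact max_lt ht (max_lt hu hv))
  exact ⟨this.1, this.2.le⟩

theorem le_of_integrableOn_ball (hd : 3 ≤ d) (hkd : k ≤ d - 2) (hk : 1 ≤ k) (hb : b 0 ≠ 0)
    (hf : f = X 0 *
      ((∑ i ∈ Finset.Icc k (d - 2), C (a i) * X 0 ^ i * X 1 ^ (d - 2 - i)) +
        ∑ j ∈ Finset.range d, C (b j) * X 0 ^ j * X 1 ^ (d - 1 - j)))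
    {e ρ : ℝ} (he : 0 ≤ e) (hρ : 0 < ρ)
    (hint : IntegrableOn (fun p : ℂ × ℂ => ‖evalFun f p‖ ^ (-e))
      (Metric.ball (0 : ℂ × ℂ) ρ) volume) :
    e * (k * d + 1) ≤ 2 * (2 * k + 1) := by
  by_contra! hlt
  obtain ⟨v₀, η, hη, B, hB, hbd⟩ := exists_weightedTransform_bounds (a := a) (k := k) hd hb
  set I := ∫⁻ p in Metric.ball (0 : ℂ × ℂ) ρ, ENNReal.ofReal (‖evalFun f p‖ ^ (-e)) with hI
  have hItop : I ≠ ⊤ := hint.lintegral_lt_top.ne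
  set D : ℝ := B ^ (-e) * (η ^ 4 * Real.pi ^ 2) with hD
  have hDpos : 0 < D := by positivity
  set σ : ℝ := 2 * (2 * k + 1) - e * (k * d + 1) with hσ
  have hσneg : σ < 0 := by linarith
  have hlow : ∀ T : ℝ, 0 < T → T < η → T ^ (k + 1) * (1 + η) < ρ → T ^ k * (‖v₀‖ + η) < ρ →
      T ^ σ * D ≤ I.toReal := by
    intro T hT hTη hT1 hT2
    have hTn : ‖(T : ℂ)‖ = T := by simp [abs_of_pos hT]
    have hTC : (T : ℂ) ≠ 0 := by exact_mod_cast hT.ne'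
    set S := Metric.ball ((T : ℂ) ^ (k + 1)) (T ^ (k + 1) * η) ×ˢ
      Metric.ball ((T : ℂ) ^ k * v₀) (T ^ k * η) with hS
    have hSρ : S ⊆ Metric.ball 0 ρ := by
      rintro ⟨x, y⟩ ⟨hx, hy⟩
      rw [Metric.mem_ball, dist_eq_norm] at hx hy
      rw [mem_ball_zero_iff, Prod.norm_def]
      refine max_lt ?_ ?_
      · have := norm_le_norm_add_norm_sub ((T : ℂ) ^ (k + 1)) x
        rw [norm_sub_rev, norm_pow, hTn] at this
        simp only at hx ⊢
        linarith
      · have := norm_le_norm_add_norm_sub ((T : ℂ) ^ k * v₀) y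
        rw [norm_sub_rev, norm_mul, norm_pow, hTn] at this
        simp only at hy ⊢
        linarith
    have hpt : ∀ p ∈ S, (T ^ (k * d + 1) * B) ^ (-e) ≤ ‖evalFun f p‖ ^ (-e) := by
      rintro ⟨x, y⟩ ⟨hx, hy⟩
      rw [Metric.mem_ball, dist_eq_norm] at hx hy
      obtain ⟨u, rfl⟩ : ∃ u, x = (T : ℂ) ^ (k + 1) * u :=
        ⟨x / T ^ (k + 1), (mul_div_cancel₀ _ (pow_ne_zero _ hTC)).symm⟩
      obtain ⟨v, rfl⟩ : ∃ v, y = (T : ℂ) ^ k * v :=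
        ⟨y / T ^ k, (mul_div_cancel₀ _ (pow_ne_zero _ hTC)).symm⟩
      have hu : ‖u - 1‖ < η := by
        have h : (T : ℂ) ^ (k + 1) * u - (T : ℂ) ^ (k + 1) = (T : ℂ) ^ (k + 1) * (u - 1) := by ring
        simp only [h, norm_mul, norm_pow, hTn] at hx
        exact lt_of_mul_lt_mul_left hx (by positivity)
      have hv : ‖v - v₀‖ < η := by
        simp only [← mul_sub, norm_mul, norm_pow, hTn] at hy
        exact lt_of_mul_lt_mul_left hy (by positivity)
      obtain ⟨hne, hle⟩ := hbd T u v (by rwa [hTn]) hu hv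
      rw [evalFun_weighted hd hkd hf, norm_mul, norm_pow, hTn]
      have := norm_pos_iff.2 hne
      exact Real.rpow_le_rpow_of_nonpos (by positivity) (by gcongr) (by linarith)
    have hIS : ENNReal.ofReal ((T ^ (k * d + 1) * B) ^ (-e)) * volume S ≤ I := by
      rw [← setLIntegral_const]
      refine le_trans (setLIntegral_mono' (measurableSet_ball.prod measurableSet_ball)
        fun p hp => ENNReal.ofReal_le_ofReal (hpt p hp)) (lintegral_mono_set hSρ)
    rw [hS, volume_ball_prod_ball _ _ (by positivity) (by positivity),
      ← ENNReal.ofReal_mul (by positivity)] at hIS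
    have h := (ENNReal.ofReal_le_iff_le_toReal hItop).1 hIS
    refine le_trans (le_of_eq ?_) h
    have h1 : T ^ σ = (T ^ (2 * k + 1)) ^ 2 * (T ^ (k * d + 1)) ^ (-e) := by
      rw [← pow_mul, ← Real.rpow_natCast, ← Real.rpow_natCast T (k * d + 1), ← Real.rpow_mul hT.le,
        ← Real.rpow_add hT]
      congr 1
      push_cast
      rw [hσ]
      ring
    rw [h1, hD, Real.mul_rpow (by positivity) (by positivity)]
    ring
  have hlim : Filter.Tendsto (fun T : ℝ => T ^ σ * D) (nhdsWithin 0 (Set.Ioi 0)) Filter.atTop :=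
    (tendsto_rpow_neg_nhdsGT_zero hσneg).atTop_mul_const hDpos
  have hsmall : ∀ (n : ℕ) (L : ℝ), n ≠ 0 →
      ∀ᶠ T : ℝ in nhdsWithin 0 (Set.Ioi 0), T ^ n * L < ρ := fun n L hn =>
    nhdsWithin_le_nhds <| (Continuous.tendsto (by fun_prop :
      Continuous fun T : ℝ => T ^ n * L) 0).eventually_lt_const (by simpa [hn] using hρ)
  obtain ⟨T, h1, h2, h3, h4, h5⟩ := ((hlim.eventually_gt_atTop I.toReal).and
    ((hsmall (k + 1) (1 + η) k.succ_ne_zero).and ((hsmall k (‖v₀‖ + η) (by omega)).and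
      ((eventually_mem_nhdsWithin).and (nhdsWithin_le_nhds (Iio_mem_nhds hη)))))).exists
  exact absurd (hlow T h4 h5 h2 h3) (not_le.2 h1)

end Threshold

theorem lct_mult_d_sub_one_line_component (d k : ℕ) (hd : 3 ≤ d) (hk : 1 ≤ k)
    (hkd : k ≤ d - 2) (hbig : 2 * k + 3 > d) (a b : ℕ → ℂ)
    (ha : a k ≠ 0) (hb : b 0 ≠ 0)
    (f : MvPolynomial (Fin 2) ℂ)
    (hf : f = X 0 *
      ((∑ i ∈ Finset.Icc k (d - 2), C (a i) * X 0 ^ i * X 1 ^ (d - 2 - i)) +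
        ∑ j ∈ Finset.range d, C (b j) * X 0 ^ j * X 1 ^ (d - 1 - j)))
    (hsf : Squarefree f) :
    lct₀ (evalFun f) = (2 * k + 1) / (k * d + 1) := by
  have hW : (0 : ℝ) < k * d + 1 := by positivity
  obtain ⟨m, hm⟩ : ∃ m, d = k + 2 + m := ⟨d - (k + 2), by omega⟩
  have hmk : m ≤ k := by omega
  have hmR : (m : ℝ) ≤ k := by exact_mod_cast hmk
  have hkR : (1 : ℝ) ≤ k := by exact_mod_cast hk
  have hm0 : (0 : ℝ) ≤ m := by positivity
  have hdR : (d : ℝ) = k + 2 + m := by rw [hm]; push_cast; ring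
  have hexists : ∀ w < ((2 * k + 1) / (k * d + 1) : ℝ), ∃ c ∈ { c : ℝ | 0 ≤ c ∧ ∃ ε : ℝ, 0 < ε ∧
      IntegrableOn (fun p : ℂ × ℂ => ‖evalFun f p‖ ^ (-2 * c)) (Metric.ball (0 : ℂ × ℂ) ε)
        volume }, w < c := by
    intro w hw
    have hN : (1 / (d - 1) : ℝ) < (2 * k + 1) / (k * d + 1) := by
      rw [div_lt_div_iff₀ (by linarith) hW, hdR]
      nlinarith
    obtain ⟨c, hc1, hc2⟩ := exists_between (max_lt hw hN)
    obtain ⟨hwc, hNc⟩ := max_lt_iff.1 hc1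
    have hd1 : (0 : ℝ) < d - 1 := by linarith
    have hc0 : 0 < c := (by positivity : (0 : ℝ) < 1 / (d - 1)).trans hNc
    rw [div_lt_iff₀ hd1] at hNc
    rw [lt_div_iff₀ hW] at hc2
    have hc1' : c < 1 := by
      by_contra! h
      have := mul_le_mul_of_nonneg_right h hW.le
      rw [hdR] at *
      nlinarith
    have hcm : c * m < 1 := by
      by_contra! h
      have h1 := mul_le_mul_of_nonneg_right h hW.le
      have h2 := mul_le_mul_of_nonneg_left hc2.le hm0
      rw [hdR] at *
      nlinarith
    refine ⟨c, ⟨hc0.le, ?_⟩, hwc⟩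
    have hM : 2 * c * (max (d - 2 - k) 1 : ℕ) < 2 := by
      rw [show d - 2 - k = m by omega]
      rcases max_choice m 1 with h | h <;> rw [h] <;> push_cast <;> linarith
    obtain ⟨ρ, hρ, h⟩ := integrableOn_ball_of_lt hd hkd ha hb hf (e := 2 * c) (by positivity) hM
      (by rw [Nat.cast_sub (by omega), Nat.cast_one]; linarith) (by linarith)
    exact ⟨ρ, hρ, by simpa only [neg_mul] using h⟩
  refine csSup_eq_of_forall_le_of_forall_lt_exists_gt ?_ ?_ hexists
  · obtain ⟨c, hc, -⟩ := hexists _ (sub_one_lt _)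
    exact ⟨c, hc⟩
  · rintro c ⟨hc0, ε, hε, hint⟩
    have h := le_of_integrableOn_ball hd hkd hk hb hf (e := 2 * c) (by positivity) hε
      (by simpa only [neg_mul] using hint)
    rw [le_div_iff₀ hW]
    linarith
end

section
/- Let d ≥ 3 and k be integers with 2 ≤ k ≤ d-1 and 2k > d-1. Let a_k, ..., a_{d-1} and b_0, ..., b_d be complex numbers with a_k ≠ 0 and b_0 ≠ 0, and let f be the bivariate polynomial f(x,y) = Σ_{i=k}^{d-1} a_i x^i y^{d-1-i} + Σ_{j=0}^{d} b_j x^j y^{d-j}. Assume f is square-free. Then lct₀(f) = (2k+1)/(kd). -/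
open MeasureTheory MvPolynomial

open scoped ENNReal

/-- The `ℝ≥0∞`-valued power `‖z‖ ^ (-s)`, equal to `⊤` at `z = 0` when `s > 0`. -/
noncomputable def negPow (s : ℝ) (z : ℂ) : ℝ≥0∞ := ‖z‖ₑ ^ (-s)

lemma negPow_mul (s : ℝ) (z w : ℂ) : negPow s (z * w) = negPow s z * negPow s w := by
  simp only [negPow, enorm_mul]
  exact ENNReal.coe_mul_rpow _ _ _

lemma negPow_pow (s : ℝ) (z : ℂ) (n : ℕ) : negPow s (z ^ n) = negPow (n * s) z := by
  simp only [negPow, enorm_pow]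
  rw [← ENNReal.rpow_natCast_mul]
  congr 1; ring

lemma negPow_anti {s : ℝ} (hs : 0 ≤ s) {z w : ℂ} (h : ‖w‖ ≤ ‖z‖) : negPow s z ≤ negPow s w := by
  simp only [negPow]
  rw [ENNReal.rpow_neg, ENNReal.rpow_neg]
  exact ENNReal.inv_le_inv.mpr (ENNReal.rpow_le_rpow (enorm_le_iff_norm_le.mpr h) hs)

lemma negPow_ne_top {s : ℝ} {z : ℂ} (hz : z ≠ 0) : negPow s z ≠ ⊤ :=
  ENNReal.rpow_ne_top_of_ne_zero (by simpa using hz) (by simp)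

lemma negPow_zero {s : ℝ} (hs : 0 < s) : negPow s 0 = ⊤ := by
  simp [negPow, hs]

lemma negPow_ne_zero {s : ℝ} (hs : 0 ≤ s) (z : ℂ) : negPow s z ≠ 0 := by
  simp [negPow, hs]

lemma negPow_add {s t : ℝ} (hs : 0 ≤ s) (ht : 0 ≤ t) (z : ℂ) :
    negPow (s + t) z = negPow s z * negPow t z := by
  rcases eq_or_ne z 0 with rfl | hz
  · rcases hs.eq_or_lt with rfl | hs
    · simp [negPow]
    rcases ht.eq_or_lt with rfl | ht
    · simp [negPow]
    rw [negPow_zero hs, negPow_zero ht, negPow_zero (by linarith), ENNReal.top_mul_top]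
  · simp only [negPow]
    rw [neg_add, ENNReal.rpow_add _ _ (by simpa using hz) (by simp)]

lemma measurable_negPow (s : ℝ) : Measurable (negPow s) := by
  unfold negPow; fun_prop

lemma ofReal_norm_rpow_le_negPow (s : ℝ) (z : ℂ) : ‖‖z‖ ^ (-s)‖ₑ ≤ negPow s z := by
  rcases eq_or_ne z 0 with rfl | hz
  · rcases eq_or_ne s 0 with rfl | hs
    · simp [negPow]
    · simp [Real.zero_rpow (neg_ne_zero.mpr hs)]
  · rw [negPow, Real.enorm_eq_ofReal (by positivity),
      ← ENNReal.ofReal_rpow_of_pos (by positivity), ofReal_norm]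

lemma ofReal_norm_rpow_eq_negPow (s : ℝ) {z : ℂ} (hz : z ≠ 0) : ‖‖z‖ ^ (-s)‖ₑ = negPow s z := by
  rw [negPow, Real.enorm_eq_ofReal (by positivity),
      ← ENNReal.ofReal_rpow_of_pos (by positivity), ofReal_norm]

lemma setLIntegral_negPow_eq (s : ℝ) (S : Set ℂ) :
    ∫⁻ z in S, negPow s z = ∫⁻ z in S, ‖‖z‖ ^ (-s)‖ₑ := by
  apply lintegral_congr_ae
  filter_upwards [(ae_restrict_of_ae (volume.ae_ne (0 : ℂ)))] with z hz
  exact (ofReal_norm_rpow_eq_negPow s hz).symm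

lemma setLIntegral_negPow_ball_lt_top_iff {s r : ℝ} (hr : 0 < r) :
    ∫⁻ z in Metric.ball 0 r, negPow s z < ⊤ ↔ s < 2 := by
  have h : IntegrableOn (fun z : ℂ => ‖z‖ ^ (-s)) (Metric.ball 0 r) ↔ s < 2 := by
    rw [integrableOn_fun_norm_addHaar volume (f := fun y => y ^ (-s)),
      ← (by constructor <;> intro h <;> linarith : -1 < 1 - s ↔ s < 2),
      ← intervalIntegral.integrableOn_Ioo_rpow_iff hr]
    refine integrableOn_congr_fun (fun y hy => ?_) measurableSet_Ioo
    rw [Complex.finrank_real_complex, sub_eq_add_neg 1 s, Real.rpow_add hy.1]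
    simp
  rw [setLIntegral_negPow_eq, ← h, IntegrableOn, Integrable, hasFiniteIntegral_iff_enorm]
  exact ⟨fun h => ⟨(measurable_norm.pow_const _).aestronglyMeasurable, h⟩, fun h => h.2⟩

lemma setLIntegral_negPow_compl_ball_lt_top {s : ℝ} (hs : 2 < s) :
    ∫⁻ z in (Metric.ball 0 1)ᶜ, negPow s z < ⊤ := by
  have h : IntegrableOn (fun z : ℂ => ‖z‖ ^ (-s)) (Metric.ball 0 1)ᶜ := by
    rw [← integrable_indicator_iff measurableSet_ball.compl]
    have : (Metric.ball (0 : ℂ) 1)ᶜ.indicator (fun z : ℂ => ‖z‖ ^ (-s)) =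
        fun z : ℂ => (Set.Ici (1 : ℝ)).indicator (fun y => y ^ (-s)) ‖z‖ := by
      ext z; simp [Set.indicator]
    rw [this, integrable_fun_norm_addHaar volume (f := (Set.Ici (1 : ℝ)).indicator fun y => y ^ (-s)),
      integrableOn_congr_fun (g := (Set.Ici (1 : ℝ)).indicator fun y => y ^ (1 - s)) _
      measurableSet_Ioi]
    · apply Integrable.integrableOn
      rw [integrable_indicator_iff measurableSet_Ici, integrableOn_Ici_iff_integrableOn_Ioi]
      exact integrableOn_Ioi_rpow_of_lt (by linarith) one_pos
    · intro y hy
      by_cases h : 1 ≤ y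
      · simp only [Set.indicator, Set.mem_Ici, h, if_true]
        rw [Complex.finrank_real_complex, sub_eq_add_neg 1 s, Real.rpow_add hy]
        simp
      · simp [Set.indicator, h]
  rw [setLIntegral_negPow_eq, ← hasFiniteIntegral_iff_enorm]
  exact h.2

lemma lintegral_eq_mul_lintegral_comp_mul {a : ℂ} (ha : a ≠ 0) (F : ℂ → ℝ≥0∞) :
    ∫⁻ x, F x = ‖a‖ₑ ^ 2 * ∫⁻ t, F (a * t) := by
  have hdet : LinearMap.det (LinearMap.mulLeft ℝ a) = ‖a‖ ^ 2 := by
    rw [← Complex.normSq_eq_norm_sq, ← Algebra.norm_complex_apply, Algebra.norm_apply]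
    rfl
  have hmap := Measure.map_linearMap_addHaar_eq_smul_addHaar (volume : Measure ℂ)
    (f := LinearMap.mulLeft ℝ a) (by rw [hdet]; simpa using ha)
  have hemb : MeasurableEmbedding (fun t : ℂ => a * t) := (Homeomorph.mulLeft₀ a ha).measurableEmbedding
  have h2 : ∫⁻ t, F (a * t) = ∫⁻ x, F x ∂(Measure.map (fun t : ℂ => a * t) volume) :=
    (hemb.lintegral_map F).symm
  have h3 : Measure.map (fun t : ℂ => a * t) volume =
      ENNReal.ofReal |(LinearMap.det (LinearMap.mulLeft ℝ a))⁻¹| • (volume : Measure ℂ) := hmap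
  rw [h2, h3, lintegral_smul_measure, hdet, smul_eq_mul, ← mul_assoc]
  have : ‖a‖ₑ ^ 2 * ENNReal.ofReal |(‖a‖ ^ 2)⁻¹| = 1 := by
    rw [abs_of_nonneg (by positivity), ENNReal.ofReal_inv_of_pos (by positivity),
      ENNReal.ofReal_pow (by positivity), ofReal_norm]
    exact ENNReal.mul_inv_cancel (by simpa using ha) (by simp)
  rw [this, one_mul]

lemma lintegral_negPow_mul_negPow_lt_top {σ τ : ℝ} (hσ : 0 ≤ σ) (hτ : 0 ≤ τ) (hσ2 : σ < 2)
    (hτ2 : τ < 2) (h : 2 < σ + τ) :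
    ∫⁻ t, negPow σ t * negPow τ (1 + t) < ⊤ := by
  let H : ℝ → ℝ → ℂ → ℝ≥0∞ := fun p q t =>
    (Metric.ball 0 1).indicator (fun t => negPow q (1 / 2) * negPow p t) t +
    (Metric.ball 0 1)ᶜ.indicator (negPow (p + q)) t
  have key : ∀ p q : ℝ, 0 ≤ p → 0 ≤ q → ∀ z w : ℂ, ‖z‖ ≤ ‖w‖ → 1 / 2 ≤ ‖w‖ →
      negPow p z * negPow q w ≤ H p q z := by
    intro p q hp hq z w hzw hw
    by_cases hz : z ∈ Metric.ball (0 : ℂ) 1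
    · simp only [H, Set.indicator_of_mem hz, Set.indicator_of_notMem (Set.notMem_compl_iff.mpr hz),
        add_zero]
      rw [mul_comm]
      gcongr
      exact negPow_anti hq (by simpa using hw)
    · simp only [H, Set.indicator_of_notMem hz, Set.indicator_of_mem (Set.mem_compl hz), zero_add]
      rw [negPow_add hp hq]
      gcongr
      exact negPow_anti hq hzw
  have hH : ∀ p q : ℝ, p < 2 → 2 < p + q → ∫⁻ t, H p q t < ⊤ := by
    intro p q hp hpq
    simp only [H]
    rw [lintegral_add_left (((measurable_negPow p).const_mul _).indicator measurableSet_ball),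
      lintegral_indicator measurableSet_ball, lintegral_indicator measurableSet_ball.compl,
      lintegral_const_mul _ (measurable_negPow p)]
    refine ENNReal.add_lt_top.mpr ⟨ENNReal.mul_lt_top ?_ ?_, ?_⟩
    · exact (negPow_ne_top (by norm_num)).lt_top
    · exact (setLIntegral_negPow_ball_lt_top_iff one_pos).mpr hp
    · exact setLIntegral_negPow_compl_ball_lt_top hpq
  have hmeas : Measurable (H σ τ) :=
    (((measurable_negPow σ).const_mul _).indicator measurableSet_ball).add
      ((measurable_negPow _).indicator measurableSet_ball.compl)
  calc ∫⁻ t, negPow σ t * negPow τ (1 + t)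
      ≤ ∫⁻ t, (H σ τ t + H τ σ (1 + t)) := by
        refine lintegral_mono fun t => ?_
        have h1 : 1 ≤ ‖1 + t‖ + ‖t‖ := by
          simpa using norm_sub_le (1 + t) t
        rcases le_total ‖t‖ ‖1 + t‖ with h | h
        · exact (key σ τ hσ hτ _ _ h (by linarith)).trans le_self_add
        · rw [mul_comm]
          exact (key τ σ hτ hσ _ _ h (by linarith)).trans le_add_self
    _ = (∫⁻ t, H σ τ t) + ∫⁻ t, H τ σ t := by
        rw [lintegral_add_left hmeas]
        congr 1
        exact lintegral_add_left_eq_self (H τ σ) 1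
    _ < ⊤ := ENNReal.add_lt_top.mpr ⟨hH σ τ hσ2 h, hH τ σ hτ2 (by linarith)⟩

lemma negPow_add_of_ne_zero (s t : ℝ) {z : ℂ} (hz : z ≠ 0) :
    negPow (s + t) z = negPow s z * negPow t z := by
  simp only [negPow]
  rw [neg_add, ENNReal.rpow_add _ _ (by simpa using hz) (by simp)]

lemma negPow_inv (s : ℝ) {z : ℂ} (hz : z ≠ 0) : negPow s z⁻¹ = negPow (-s) z := by
  simp only [negPow]
  rw [enorm_inv hz, ENNReal.inv_rpow, ← ENNReal.rpow_neg]

lemma enorm_sq_eq_negPow (z : ℂ) : ‖z‖ₑ ^ 2 = negPow (-2) z := by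
  simp [negPow]

lemma exists_lintegral_affine_le_mul {σ τ : ℝ} (hσ : 0 ≤ σ) (hτ : 0 ≤ τ) (hσ2 : σ < 2)
    (hτ2 : τ < 2) (h : 2 < σ + τ) :
    ∃ C : ℝ≥0∞, C ≠ ⊤ ∧ ∀ a b : ℂ,
      ∫⁻ y, negPow σ y * negPow τ (a + y * b) ≤
        C * (negPow (σ + τ - 2) a * negPow (2 - σ) b) := by
  refine ⟨(∫⁻ t, negPow σ t * negPow τ (1 + t)) + 1, ?_, fun a b => ?_⟩
  · exact (ENNReal.add_lt_top.mpr
      ⟨lintegral_negPow_mul_negPow_lt_top hσ hτ hσ2 hτ2 h, ENNReal.one_lt_top⟩).ne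
  rcases eq_or_ne a 0 with rfl | ha
  · rw [negPow_zero (s := σ + τ - 2) (by linarith),
      ENNReal.top_mul (negPow_ne_zero (by linarith) b), ENNReal.mul_top (by simp)]
    exact le_top
  rcases eq_or_ne b 0 with rfl | hb
  · rw [negPow_zero (s := 2 - σ) (by linarith),
      ENNReal.mul_top (negPow_ne_zero (by linarith) a), ENNReal.mul_top (by simp)]
    exact le_top
  have hab : a * b⁻¹ ≠ 0 := mul_ne_zero ha (inv_ne_zero hb)
  rw [lintegral_eq_mul_lintegral_comp_mul hab]
  have hpt : ∀ t : ℂ, negPow σ (a * b⁻¹ * t) * negPow τ (a + a * b⁻¹ * t * b) =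
      negPow σ (a * b⁻¹) * negPow τ a * (negPow σ t * negPow τ (1 + t)) := by
    intro t
    have : a + a * b⁻¹ * t * b = a * (1 + t) := by field_simp
    rw [this, negPow_mul σ, negPow_mul τ]
    ring
  simp_rw [hpt]
  rw [lintegral_const_mul _ (by
    exact (measurable_negPow σ).mul ((measurable_negPow τ).comp (measurable_const_add 1)))]
  have hfac : ‖a * b⁻¹‖ₑ ^ 2 * (negPow σ (a * b⁻¹) * negPow τ a) =
      negPow (σ + τ - 2) a * negPow (2 - σ) b := by
    rw [enorm_sq_eq_negPow, ← mul_assoc, ← negPow_add_of_ne_zero _ _ hab, negPow_mul,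
      negPow_inv _ hb, mul_right_comm, ← negPow_add_of_ne_zero _ _ ha]
    congr 2 <;> ring
  rw [← mul_assoc, hfac, mul_comm]
  gcongr
  exact le_self_add

lemma exists_setLIntegral_affine_le {σ τ : ℝ} (hσ : 0 ≤ σ) (hτ : 0 ≤ τ) (hσ2 : σ < 2)
    (hτ2 : τ < 2) (h : 2 < σ + τ) :
    ∃ C : ℝ≥0∞, C ≠ ⊤ ∧ ∀ a b : ℂ,
      ∫⁻ y in Metric.ball 0 1, negPow σ y * negPow τ (a + y * b) ≤ C * negPow τ a := by
  obtain ⟨C, hC, hCab⟩ := exists_lintegral_affine_le_mul hσ hτ hσ2 hτ2 h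
  have htwo : ∀ s : ℝ, negPow s (1 / 2) ≠ ⊤ := fun s => negPow_ne_top (by norm_num)
  refine ⟨negPow τ (1 / 2) * (∫⁻ y in Metric.ball 0 1, negPow σ y) + C * negPow (2 - σ) (1 / 2),
    ?_, fun a b => ?_⟩
  · refine ENNReal.add_ne_top.mpr ⟨ENNReal.mul_ne_top (htwo _) ?_, ENNReal.mul_ne_top hC (htwo _)⟩
    exact ((setLIntegral_negPow_ball_lt_top_iff one_pos).mpr hσ2).ne
  rw [add_mul]
  rcases le_total (‖a‖ / 2) ‖b‖ with hab | hab
  · refine le_trans ?_ le_add_self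
    calc _ ≤ ∫⁻ y, negPow σ y * negPow τ (a + y * b) := setLIntegral_le_lintegral _ _
      _ ≤ C * (negPow (σ + τ - 2) a * negPow (2 - σ) b) := hCab a b
      _ ≤ C * (negPow (σ + τ - 2) a * negPow (2 - σ) (1 / 2 * a)) := by
          gcongr
          refine negPow_anti (by linarith) ?_
          rw [norm_mul]; norm_num; linarith
      _ = C * negPow (2 - σ) (1 / 2) * negPow τ a := by
          have : τ = (σ + τ - 2) + (2 - σ) := by ring
          conv_rhs => rw [this, negPow_add (by linarith) (by linarith)]
          rw [negPow_mul]; ring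
  · refine le_trans ?_ le_self_add
    calc _ ≤ ∫⁻ y in Metric.ball 0 1, negPow σ y * negPow τ (1 / 2 * a) := by
          refine setLIntegral_mono' measurableSet_ball fun y hy => ?_
          gcongr
          refine negPow_anti hτ ?_
          have hy' : ‖y‖ < 1 := by simpa using hy
          have h1 : ‖a‖ ≤ ‖a + y * b‖ + ‖y * b‖ := by simpa using norm_sub_le (a + y * b) (y * b)
          rw [norm_mul y] at h1
          have h2 : ‖y‖ * ‖b‖ ≤ 1 * (‖a‖ / 2) := by gcongr
          rw [norm_mul]; norm_num; linarith
      _ = _ := by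
          rw [lintegral_mul_const _ (measurable_negPow σ), negPow_mul]; ring

lemma exists_negPow_eval_le (P : Polynomial ℂ) (hP : P ≠ 0) (u₀ : ℂ) {s : ℝ} (hs : 0 ≤ s) :
    ∃ C : ℝ≥0∞, C ≠ ⊤ ∧ ∀ᶠ u in nhds u₀,
      negPow s (P.eval u) ≤ C * negPow (P.rootMultiplicity u₀ * s) (u - u₀) := by
  obtain ⟨R, hR, hdvd⟩ := Polynomial.exists_eq_pow_rootMultiplicity_mul_and_not_dvd P hP u₀
  have hR0 : R.eval u₀ ≠ 0 := by rwa [Polynomial.dvd_iff_isRoot] at hdvd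
  refine ⟨negPow s (1 / 2 * R.eval u₀), negPow_ne_top (by simpa using hR0), ?_⟩
  have hlt : ‖1 / 2 * R.eval u₀‖ < ‖R.eval u₀‖ := by
    have := norm_pos_iff.mpr hR0
    rw [norm_mul]; norm_num; linarith
  have hev := (R.continuous.norm.tendsto u₀).eventually_const_lt hlt
  filter_upwards [hev] with u hu
  conv_lhs => rw [hR]
  rw [Polynomial.eval_mul, negPow_mul, mul_comm]
  gcongr
  · exact negPow_anti hs hu.le
  · simp [negPow_pow]

lemma exists_nhds_setLIntegral_lt_top {G : ℂ → ℝ≥0∞} {u₀ : ℂ} {γ : ℝ} (hγ : γ < 2) {C : ℝ≥0∞}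
    (hC : C ≠ ⊤) (hG : ∀ᶠ u in nhds u₀, G u ≤ C * negPow γ (u - u₀)) :
    ∃ U ∈ nhds u₀, ∫⁻ u in U, G u < ⊤ := by
  obtain ⟨r, hr, hball⟩ := Metric.eventually_nhds_iff_ball.mp hG
  refine ⟨Metric.ball u₀ r, Metric.ball_mem_nhds _ hr, ?_⟩
  calc _ ≤ ∫⁻ u in Metric.ball u₀ r, C * negPow γ (u - u₀) :=
        setLIntegral_mono' measurableSet_ball hball
    _ = ∫⁻ u, (Metric.ball 0 r).indicator (fun v => C * negPow γ v) (u - u₀) := by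
        rw [← lintegral_indicator measurableSet_ball]
        refine lintegral_congr fun u => ?_
        simp [Set.indicator, dist_eq_norm]
    _ = C * ∫⁻ v in Metric.ball 0 r, negPow γ v := by
        rw [lintegral_sub_right_eq_self
          ((Metric.ball (0 : ℂ) r).indicator (fun v => C * negPow γ v)) u₀,
          lintegral_indicator measurableSet_ball, lintegral_const_mul _ (measurable_negPow γ)]
    _ < ⊤ := ENNReal.mul_lt_top hC.lt_top ((setLIntegral_negPow_ball_lt_top_iff hr).mpr hγ)

lemma setLIntegral_lt_top_of_isCompact {K : Set ℂ} (hK : IsCompact K) {G : ℂ → ℝ≥0∞}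
    (h : ∀ u ∈ K, ∃ U ∈ nhds u, ∫⁻ u in U, G u < ⊤) : ∫⁻ u in K, G u < ⊤ := by
  refine hK.induction_on (p := fun s => ∫⁻ u in s, G u < ⊤) (by simp)
    (fun s t hst ht => (lintegral_mono_set hst).trans_lt ht)
    (fun s t hs ht => (lintegral_union_le G s t).trans_lt (ENNReal.add_lt_top.mpr ⟨hs, ht⟩))
    (fun u hu => ?_)
  obtain ⟨U, hU, hU'⟩ := h u hu
  exact ⟨U, mem_nhdsWithin_of_mem_nhds hU, hU'⟩

/-- Finiteness of the integral over the cone `‖x‖ ≤ ‖y‖` of a function with exactly two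
homogeneous parts, of degrees `n` and `n + 1`, given in the chart `x = u * y`. -/
lemma setLIntegral_cone_lt_top {n : ℕ} {c : ℝ} (hc1 : c < 1) (hn0 : 2 ≤ 2 * c * n)
    (hn2 : 2 * c * n < 4) (hn : 4 < 2 * c * (n + 1)) {P Q : Polynomial ℂ} (hP : P ≠ 0) (hQ : Q ≠ 0)
    (hPQ : ∀ u, P.rootMultiplicity u * (2 * c) < 2 ∨
      P.rootMultiplicity u * (2 * c * (n + 1) - 4) + Q.rootMultiplicity u * (4 - 2 * c * n) < 2)
    {F : ℂ → ℂ → ℂ} (hF : ∀ u y, F (y * u) y = y ^ n * (P.eval u + y * Q.eval u)) :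
    ∫⁻ y in Metric.ball 0 1, ∫⁻ x in Metric.closedBall 0 ‖y‖, negPow (2 * c) (F x y) < ⊤ := by
  set τ := 2 * c with hτ
  set σ := n * τ - 2 with hσ
  have hσ0 : 0 ≤ σ := by linarith [hn0]
  have hσ2 : σ < 2 := by simp only [hσ]; linarith
  have hστ : 2 < σ + τ := by simp only [hσ]; linarith
  have hτ0 : 0 ≤ τ := by
    by_contra! h
    nlinarith [(Nat.cast_nonneg n : (0 : ℝ) ≤ n)]
  have hτ2 : τ < 2 := by linarith
  have hchart : ∀ y : ℂ, y ≠ 0 → ∫⁻ x in Metric.closedBall 0 ‖y‖, negPow τ (F x y) =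
      ∫⁻ u in Metric.closedBall 0 1, negPow σ y * negPow τ (P.eval u + y * Q.eval u) := by
    intro y hy
    rw [← lintegral_indicator measurableSet_closedBall, lintegral_eq_mul_lintegral_comp_mul hy,
      ← lintegral_const_mul' _ _ (by simp), ← lintegral_indicator measurableSet_closedBall]
    refine lintegral_congr fun u => ?_
    have hmem : y * u ∈ Metric.closedBall (0 : ℂ) ‖y‖ ↔ u ∈ Metric.closedBall (0 : ℂ) 1 := by
      simp [hy]
    by_cases hu : u ∈ Metric.closedBall (0 : ℂ) 1
    · rw [Set.indicator_of_mem hu, Set.indicator_of_mem (hmem.mpr hu), hF, negPow_mul, negPow_pow,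
        ← mul_assoc, enorm_sq_eq_negPow, ← negPow_add_of_ne_zero _ _ hy]
      congr 2; simp only [hσ]; ring
    · rw [Set.indicator_of_notMem hu, Set.indicator_of_notMem (fun h => hu (hmem.mp h)), mul_zero]
  have hmeas : Measurable fun p : ℂ × ℂ => negPow σ p.1 * negPow τ (P.eval p.2 + p.1 * Q.eval p.2) := by
    refine ((measurable_negPow σ).comp measurable_fst).mul ((measurable_negPow τ).comp ?_)
    exact ((P.continuous.comp continuous_snd).add
      (continuous_fst.mul (Q.continuous.comp continuous_snd))).measurable
  calc ∫⁻ y in Metric.ball 0 1, ∫⁻ x in Metric.closedBall 0 ‖y‖, negPow τ (F x y)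
      = ∫⁻ y in Metric.ball 0 1, ∫⁻ u in Metric.closedBall 0 1,
          negPow σ y * negPow τ (P.eval u + y * Q.eval u) := by
        refine lintegral_congr_ae ?_
        filter_upwards [ae_restrict_of_ae (volume.ae_ne (0 : ℂ))] with y hy using hchart y hy
    _ = ∫⁻ u in Metric.closedBall 0 1, ∫⁻ y in Metric.ball 0 1,
          negPow σ y * negPow τ (P.eval u + y * Q.eval u) :=
        lintegral_lintegral_swap hmeas.aemeasurable
    _ < ⊤ := by
        refine setLIntegral_lt_top_of_isCompact (isCompact_closedBall 0 1) fun u₀ _ => ?_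
        obtain ⟨CP, hCP, hP'⟩ := exists_negPow_eval_le P hP u₀ hτ0
        rcases hPQ u₀ with hu | hu
        · obtain ⟨C, hC, hI⟩ := exists_setLIntegral_affine_le hσ0 hτ0 hσ2 hτ2 hστ
          refine exists_nhds_setLIntegral_lt_top hu (ENNReal.mul_ne_top hC hCP) ?_
          filter_upwards [hP'] with u hu'
          refine (hI _ _).trans ?_
          rw [mul_assoc]
          gcongr
        · obtain ⟨C, hC, hI⟩ := exists_lintegral_affine_le_mul hσ0 hτ0 hσ2 hτ2 hστ
          obtain ⟨C₁, hC₁, hP₁⟩ := exists_negPow_eval_le P hP u₀ (s := σ + τ - 2) (by linarith)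
          obtain ⟨C₂, hC₂, hQ₂⟩ := exists_negPow_eval_le Q hQ u₀ (s := 2 - σ) (by linarith)
          refine exists_nhds_setLIntegral_lt_top (C := C * (C₁ * C₂)) hu
            (ENNReal.mul_ne_top hC (ENNReal.mul_ne_top hC₁ hC₂)) ?_
          filter_upwards [hP₁, hQ₂] with u h₁ h₂
          refine (setLIntegral_le_lintegral _ _).trans ((hI _ _).trans ?_)
          rw [mul_assoc]
          refine mul_le_mul' le_rfl ((mul_le_mul' h₁ h₂).trans_eq ?_)
          have e1 : σ + τ - 2 = τ * (n + 1) - 4 := by simp only [hσ]; ring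
          have e2 : 2 - σ = 4 - τ * n := by simp only [hσ]; ring
          rw [e1, e2, negPow_add (mul_nonneg (by positivity) (by linarith))
            (mul_nonneg (by positivity) (by linarith))]
          ring

lemma setLIntegral_region {g : ℂ × ℂ → ℝ≥0∞} (hg : Measurable g) {r : ℂ → ℝ} (hr : Measurable r)
    (ε : ℝ) :
    ∫⁻ p in {p : ℂ × ℂ | ‖p.2‖ < ε ∧ ‖p.1‖ ≤ r p.2}, g p =
      ∫⁻ y in Metric.ball 0 ε, ∫⁻ x in Metric.closedBall 0 (r y), g (x, y) := by
  have hS : MeasurableSet {p : ℂ × ℂ | ‖p.2‖ < ε ∧ ‖p.1‖ ≤ r p.2} :=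
    (measurableSet_lt measurable_snd.norm measurable_const).inter
      (measurableSet_le measurable_fst.norm (hr.comp measurable_snd))
  rw [← lintegral_indicator hS, Measure.volume_eq_prod,
    lintegral_prod_symm' _ (hg.indicator hS), ← lintegral_indicator measurableSet_ball]
  refine lintegral_congr fun y => ?_
  by_cases hy : ‖y‖ < ε
  · rw [Set.indicator_of_mem (by simpa using hy), ← lintegral_indicator measurableSet_closedBall]
    refine lintegral_congr fun x => ?_
    simp [Set.indicator, hy]
  · rw [Set.indicator_of_notMem (by simpa using hy)]
    simp [Set.indicator, hy]

lemma setLIntegral_ball_lt_top_of_cones {g : ℂ × ℂ → ℝ≥0∞} (hg : Measurable g)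
    (h₁ : ∫⁻ y in Metric.ball 0 1, ∫⁻ x in Metric.closedBall 0 ‖y‖, g (x, y) < ⊤)
    (h₂ : ∫⁻ y in Metric.ball 0 1, ∫⁻ x in Metric.closedBall 0 ‖y‖, g (y, x) < ⊤) :
    ∫⁻ p in Metric.ball 0 1, g p < ⊤ := by
  set S : Set (ℂ × ℂ) := {p | ‖p.2‖ < 1 ∧ ‖p.1‖ ≤ ‖p.2‖}
  have hsub : Metric.ball (0 : ℂ × ℂ) 1 ⊆ S ∪ Prod.swap ⁻¹' S := by
    intro p hp
    have hp' : ‖p.1‖ < 1 ∧ ‖p.2‖ < 1 := by simpa [Prod.norm_def] using hp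
    rcases le_total ‖p.1‖ ‖p.2‖ with h | h
    · exact Or.inl ⟨hp'.2, h⟩
    · exact Or.inr ⟨hp'.1, h⟩
  refine (lintegral_mono_set hsub).trans_lt ((lintegral_union_le _ _ _).trans_lt
    (ENNReal.add_lt_top.mpr ⟨?_, ?_⟩))
  · rwa [setLIntegral_region hg measurable_norm]
  · have hpre : MeasurePreserving (Prod.swap : ℂ × ℂ → ℂ × ℂ) volume volume :=
      Measure.measurePreserving_swap
    have := hpre.setLIntegral_comp_preimage_emb
      (MeasurableEquiv.prodComm (α := ℂ) (β := ℂ)).measurableEmbedding (fun p => g p.swap) S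
    simp only [Prod.swap_swap] at this
    have h := setLIntegral_region (hg.comp measurable_swap) measurable_norm 1
    simp only [Function.comp_apply, Prod.swap_prod_mk] at h
    rwa [this, h]

/-- Non-integrability criterion on a weighted region `‖x‖ ≤ δ * ‖y‖ ^ κ`. -/
lemma lt_of_integrableOn_ball {F : ℂ × ℂ → ℂ} (hF : Continuous F) {d : ℕ} {c δ κ M ε : ℝ}
    (hc : 0 ≤ c) (hδ : 0 < δ) (hδ1 : δ ≤ 1) (hκ : 1 ≤ κ) (hM : 0 < M) (hε : 0 < ε)
    (hbd : ∀ x y : ℂ, y ≠ 0 → ‖y‖ < 1 → ‖x‖ ≤ δ * ‖y‖ ^ κ →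
      F (x, y) ≠ 0 ∧ ‖F (x, y)‖ ≤ M * ‖y‖ ^ d)
    (hint : IntegrableOn (fun p : ℂ × ℂ => ‖F p‖ ^ (-2 * c)) (Metric.ball 0 ε)) :
    2 * c * d - 2 * κ < 2 := by
  set ρ := min ε 1
  have hρ : 0 < ρ := lt_min hε one_pos
  have hsub : {p : ℂ × ℂ | ‖p.2‖ < ρ ∧ ‖p.1‖ ≤ δ * ‖p.2‖ ^ κ} ⊆ Metric.ball 0 ε := by
    rintro p ⟨h2, h1⟩
    have hy1 : ‖p.2‖ < 1 := h2.trans_le (min_le_right _ _)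
    have hyε : ‖p.2‖ < ε := h2.trans_le (min_le_left _ _)
    have h3 : ‖p.2‖ ^ κ ≤ ‖p.2‖ := Real.rpow_le_self_of_le_one (norm_nonneg _) hy1.le hκ
    have h4 : δ * ‖p.2‖ ^ κ ≤ 1 * ‖p.2‖ := by gcongr
    have : ‖p.1‖ < ε ∧ ‖p.2‖ < ε := ⟨by linarith, hyε⟩
    simpa [Prod.norm_def] using this
  have hlt : ∫⁻ p in {p : ℂ × ℂ | ‖p.2‖ < ρ ∧ ‖p.1‖ ≤ δ * ‖p.2‖ ^ κ}, ‖‖F p‖ ^ (-2 * c)‖ₑ < ⊤ :=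
    (lintegral_mono_set hsub).trans_lt hint.2
  rw [setLIntegral_region (g := fun p : ℂ × ℂ => ‖‖F p‖ ^ (-2 * c)‖ₑ)
    (r := fun y => δ * ‖y‖ ^ κ) ((hF.norm.measurable.pow_const _).enorm) (by fun_prop)] at hlt
  set K : ℝ≥0∞ := negPow (2 * c) M * (ENNReal.ofReal δ ^ 2 * NNReal.pi)
  have hK0 : K ≠ 0 := by
    refine mul_ne_zero (negPow_ne_zero (by linarith) _) (mul_ne_zero ?_ ?_)
    · simpa using hδ
    · simpa using NNReal.pi_ne_zero
  have hle : ∫⁻ y in Metric.ball 0 ρ, K * negPow (2 * c * d - 2 * κ) y ≤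
      ∫⁻ y in Metric.ball 0 ρ, ∫⁻ x in Metric.closedBall 0 (δ * ‖y‖ ^ κ),
        ‖‖F (x, y)‖ ^ (-2 * c)‖ₑ := by
    refine lintegral_mono_ae ?_
    filter_upwards [ae_restrict_of_ae (volume.ae_ne (0 : ℂ)),
      ae_restrict_mem measurableSet_ball] with y hy0 hy
    have hy1 : ‖y‖ < 1 := (by simpa using hy : ‖y‖ < ρ).trans_le (min_le_right _ _)
    have hconst : K * negPow (2 * c * d - 2 * κ) y =
        ∫⁻ x in Metric.closedBall (0 : ℂ) (δ * ‖y‖ ^ κ), negPow (2 * c) (M * y ^ d) := by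
      rw [setLIntegral_const, Complex.volume_closedBall, ENNReal.ofReal_mul hδ.le, mul_pow,
        negPow_mul, negPow_pow, ← ENNReal.ofReal_rpow_of_pos (by positivity), ofReal_norm,
        ← ENNReal.rpow_mul_natCast, sub_eq_add_neg, negPow_add_of_ne_zero _ _ hy0]
      have e1 : negPow (-(2 * κ)) y = ‖y‖ₑ ^ (κ * (2 : ℕ)) := by
        rw [negPow]; congr 1; push_cast; ring
      rw [e1, mul_comm (2 * c) (d : ℝ)]
      ring
    rw [hconst]
    refine setLIntegral_mono' measurableSet_closedBall fun x hx => ?_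
    obtain ⟨hne, hup⟩ := hbd x y hy0 hy1 (by simpa using hx)
    rw [neg_mul, ofReal_norm_rpow_eq_negPow _ hne]
    refine negPow_anti (by linarith) (hup.trans_eq ?_)
    rw [norm_mul, norm_pow, Complex.norm_real, Real.norm_of_nonneg hM.le]
  have hfin := hle.trans_lt hlt
  rw [lintegral_const_mul _ (measurable_negPow _)] at hfin
  rw [← setLIntegral_negPow_ball_lt_top_iff hρ]
  by_contra h
  rw [not_lt_top_iff.mp h, ENNReal.mul_top hK0] at hfin
  exact lt_irrefl _ hfin

open scoped Polynomial in
lemma not_sq_dvd_of_squarefree_homogenize {n m : ℕ} (hn : 2 ≤ n) (hm : 2 ≤ m) {P Q : ℂ[X]}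
    (hP : P.natDegree ≤ n) (hQ : Q.natDegree ≤ m) {s t : MvPolynomial (Fin 2) ℂ}
    (hs : constantCoeff s = 0) (ht : constantCoeff t = 0)
    (hsf : Squarefree (aeval ![s, t] (P.homogenize n) + aeval ![s, t] (Q.homogenize m))) (u : ℂ) :
    ¬ ((Polynomial.X - Polynomial.C u) ^ 2 ∣ P ∧ (Polynomial.X - Polynomial.C u) ^ 2 ∣ Q) := by
  rintro ⟨hP2, hQ2⟩
  set L : MvPolynomial (Fin 2) ℂ := aeval ![s, t] ((Polynomial.X - Polynomial.C u).homogenize 1)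
  have hL : constantCoeff L = 0 := by simp [L, hs, ht]
  have hdvd : ∀ (R : ℂ[X]) (l : ℕ), 2 ≤ l → R.natDegree ≤ l →
      (Polynomial.X - Polynomial.C u) ^ 2 ∣ R → L * L ∣ aeval ![s, t] (R.homogenize l) := by
    rintro R l hl hR ⟨S, rfl⟩
    have hS : S.natDegree ≤ l - 2 := by
      rcases eq_or_ne S 0 with rfl | hS
      · simp
      have hmonic : ((Polynomial.X - Polynomial.C u) ^ 2).Monic :=
        (Polynomial.monic_X_sub_C u).pow 2
      rw [hmonic.natDegree_mul' hS, Polynomial.natDegree_pow, Polynomial.natDegree_X_sub_C] at hR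
      omega
    obtain ⟨l, rfl⟩ := Nat.exists_eq_add_of_le hl
    have h1 : (Polynomial.X - Polynomial.C u).natDegree ≤ 1 := (Polynomial.natDegree_X_sub_C u).le
    rw [Polynomial.homogenize_mul _ _ (m := 2) (n := l) (by simp) (by omega), sq,
      Polynomial.homogenize_mul _ _ (m := 1) (n := 1) h1 h1, map_mul, map_mul]
    exact dvd_mul_right _ _
  have hunit := hsf L (dvd_add (hdvd P n hn hP hP2) (hdvd Q m hm hQ hQ2))
  have := hunit.map (constantCoeff (σ := Fin 2) (R := ℂ))
  rw [hL] at this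
  exact not_isUnit_zero this

lemma rootMultiplicity_le_natDegree (P : Polynomial ℂ) (u : ℂ) :
    P.rootMultiplicity u ≤ P.natDegree := by
  rw [← Polynomial.count_roots]
  exact (Multiset.count_le_card _ _).trans P.card_roots'

/-- The local integrability condition of `setLIntegral_cone_lt_top`, from bounds on the orders
of vanishing `m` and `e` of the two homogeneous parts. -/
lemma order_condition {d k m e : ℕ} {c : ℝ} (hd : 3 ≤ d) (hbig : d ≤ 2 * k)
    (hc1 : c < 1) (hcd : 2 < c * d) (hc : c * (k * d) < 2 * k + 1)
    (h : (m ≤ k ∧ e = 0) ∨ m + k + 1 ≤ d) (hme : ¬ (2 ≤ m ∧ 2 ≤ e)) :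
    m * (2 * c) < 2 ∨ m * (2 * c * d - 4) + e * (4 - 2 * c * (d - 1 : ℝ)) < 2 := by
  have hd' : (3 : ℝ) ≤ d := by exact_mod_cast hd
  have hbig' : (d : ℝ) ≤ 2 * k := by exact_mod_cast hbig
  have hk0 : (0 : ℝ) < k := by linarith
  have hcd1 : c * (d - 1) < 2 := by
    have h1 : c * (k * d) * (d - 1) < 2 * (k * d) := by
      calc c * (k * d) * (d - 1) < (2 * k + 1) * (d - 1) := by gcongr; linarith
        _ ≤ 2 * (k * d) := by nlinarith
    have h2 : (0 : ℝ) < k * d := by positivity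
    by_contra! h3
    nlinarith
  by_cases hm1 : m ≤ 1
  · left
    have : (m : ℝ) ≤ 1 := by exact_mod_cast hm1
    have hc0 : 0 < c := by
      by_contra! h0
      nlinarith
    nlinarith
  right
  by_cases h0 : m ≤ k ∧ e = 0
  · have : (m : ℝ) ≤ k := by exact_mod_cast h0.1
    rw [h0.2]
    have : m * (2 * c * d - 4) ≤ k * (2 * c * d - 4) := by gcongr; linarith
    push_cast
    nlinarith
  · have he : (e : ℝ) ≤ 1 := by
      have : e ≤ 1 := by omega
      exact_mod_cast this
    have hm2 : (2 : ℝ) * m + 1 ≤ d := by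
      have : 2 * m + 1 ≤ d := by omega
      exact_mod_cast this
    have hm2' : (2 : ℝ) ≤ m := by
      have : 2 ≤ m := by omega
      exact_mod_cast this
    have h1 : e * (4 - 2 * c * (d - 1 : ℝ)) ≤ 1 * (4 - 2 * c * (d - 1 : ℝ)) := by
      gcongr; linarith
    have h2 : c * (d - 1) * (d * m - d + 1) < 2 * (d * m - d + 1) := by
      gcongr
      nlinarith
    have h3 : 2 * (d * m - d + 1) ≤ (2 * m - 1) * (d - 1 : ℝ) := by nlinarith
    have h4 : c * (d * m - d + 1) < 2 * m - 1 := by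
      by_contra! h5
      nlinarith
    nlinarith

lemma integrableOn_of_charts {P Q P' Q' : Polynomial ℂ} {d k : ℕ} {c : ℝ} (hd : 3 ≤ d) (hk : 2 ≤ k)
    (hbig : d ≤ 2 * k) (hcd : 2 < c * d) (hc : c * (k * d) < 2 * k + 1)
    (hP : P ≠ 0) (hQ : Q ≠ 0) (hP' : P' ≠ 0) (hQ' : Q' ≠ 0)
    (hord : ∀ u, (P.rootMultiplicity u ≤ k ∧ Q.rootMultiplicity u = 0) ∨
      P.rootMultiplicity u + k + 1 ≤ d)
    (hord' : ∀ u, P'.rootMultiplicity u + k + 1 ≤ d)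
    (hsq : ∀ u, ¬ ((Polynomial.X - Polynomial.C u) ^ 2 ∣ P ∧ (Polynomial.X - Polynomial.C u) ^ 2 ∣ Q))
    (hsq' : ∀ u, ¬ ((Polynomial.X - Polynomial.C u) ^ 2 ∣ P' ∧
      (Polynomial.X - Polynomial.C u) ^ 2 ∣ Q'))
    {F : ℂ × ℂ → ℂ} (hFc : Continuous F)
    (hF : ∀ u y, F (y * u, y) = y ^ (d - 1) * (P.eval u + y * Q.eval u))
    (hF' : ∀ u x, F (x, x * u) = x ^ (d - 1) * (P'.eval u + x * Q'.eval u)) :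
    IntegrableOn (fun p : ℂ × ℂ => ‖F p‖ ^ (-2 * c)) (Metric.ball 0 1) := by
  have hd' : (3 : ℝ) ≤ d := by exact_mod_cast hd
  have hk' : (2 : ℝ) ≤ k := by exact_mod_cast hk
  have hbig' : (d : ℝ) ≤ 2 * k := by exact_mod_cast hbig
  have hn : ((d - 1 : ℕ) : ℝ) = d - 1 := by push_cast [Nat.cast_sub (by omega : 1 ≤ d)]; ring
  have hkd : (0 : ℝ) < k * d := by positivity
  have hc1 : c < 1 := by
    by_contra! h
    nlinarith
  have hn0 : 2 ≤ 2 * c * (d - 1 : ℕ) := by rw [hn]; nlinarith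
  have hn2 : 2 * c * (d - 1 : ℕ) < 4 := by
    rw [hn]
    have h1 : c * (k * d) * (d - 1) < 2 * (k * d) := by
      calc c * (k * d) * (d - 1) < (2 * k + 1) * (d - 1) := by gcongr; linarith
        _ ≤ 2 * (k * d) := by nlinarith
    by_contra! h3
    nlinarith
  have hn4 : 4 < 2 * c * ((d - 1 : ℕ) + 1) := by rw [hn]; linarith
  have hcond : ∀ R S : Polynomial ℂ, R ≠ 0 → S ≠ 0 →
      (∀ u, (R.rootMultiplicity u ≤ k ∧ S.rootMultiplicity u = 0) ∨
        R.rootMultiplicity u + k + 1 ≤ d) →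
      (∀ u, ¬ ((Polynomial.X - Polynomial.C u) ^ 2 ∣ R ∧
        (Polynomial.X - Polynomial.C u) ^ 2 ∣ S)) →
      ∀ u, R.rootMultiplicity u * (2 * c) < 2 ∨
        R.rootMultiplicity u * (2 * c * ((d - 1 : ℕ) + 1) - 4) +
          S.rootMultiplicity u * (4 - 2 * c * (d - 1 : ℕ)) < 2 := by
    intro R S hR hS ho hs u
    rw [hn, sub_add_cancel]
    refine order_condition hd hbig hc1 hcd hc (ho u) fun h => hs u ?_
    exact ⟨(Polynomial.le_rootMultiplicity_iff hR).mp h.1,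
      (Polynomial.le_rootMultiplicity_iff hS).mp h.2⟩
  have h₁ := setLIntegral_cone_lt_top hc1 hn0 hn2 hn4 hP hQ (hcond P Q hP hQ hord hsq)
    (F := fun x y => F (x, y)) hF
  have h₂ := setLIntegral_cone_lt_top hc1 hn0 hn2 hn4 hP' hQ'
    (hcond P' Q' hP' hQ' (fun u => Or.inr (hord' u)) hsq') (F := fun x y => F (y, x)) hF'
  have hfin := setLIntegral_ball_lt_top_of_cones (g := fun p => negPow (2 * c) (F p))
    ((measurable_negPow _).comp hFc.measurable) h₁ h₂
  refine ⟨(hFc.norm.measurable.pow_const _).aestronglyMeasurable, ?_⟩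
  refine lt_of_le_of_lt (lintegral_mono fun p => ?_) hfin
  rw [neg_mul]
  exact ofReal_norm_rpow_le_negPow _ _

lemma norm_sub_monomial_le {d k : ℕ} (hk : 1 ≤ k) (a b : ℕ → ℂ) {δ : ℝ} (hδ : 0 ≤ δ) (hδ1 : δ ≤ 1)
    {x y : ℂ} (hy : y ≠ 0) (hy1 : ‖y‖ < 1) (hx : ‖x‖ ≤ δ * ‖y‖ ^ (1 + 1 / k : ℝ)) :
    ‖∑ i ∈ Finset.Icc k (d - 1), a i * x ^ i * y ^ (d - 1 - i) +
        ∑ j ∈ Finset.range (d + 1), b j * x ^ j * y ^ (d - j) - b 0 * y ^ d‖ ≤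
      δ * (∑ i ∈ Finset.Icc k (d - 1), ‖a i‖ + ∑ j ∈ Finset.range d, ‖b (j + 1)‖) * ‖y‖ ^ d := by
  have hy0 : 0 < ‖y‖ := norm_pos_iff.mpr hy
  have hk0 : (0 : ℝ) < k := by exact_mod_cast hk
  have hxpow : ∀ i, 1 ≤ i → ‖x‖ ^ i ≤ δ * (‖y‖ ^ (1 + 1 / k : ℝ)) ^ i := by
    intro i hi
    calc ‖x‖ ^ i ≤ (δ * ‖y‖ ^ (1 + 1 / k : ℝ)) ^ i := by gcongr
      _ = δ ^ i * (‖y‖ ^ (1 + 1 / k : ℝ)) ^ i := mul_pow _ _ _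
      _ ≤ _ := by
        gcongr
        exact pow_le_of_le_one hδ hδ1 (by omega)
  have hb : ∀ j ∈ Finset.range d, ‖b (j + 1) * x ^ (j + 1) * y ^ (d - (j + 1))‖ ≤
      δ * ‖b (j + 1)‖ * ‖y‖ ^ d := by
    intro j hj
    have hj' := Finset.mem_range.mp hj
    have h1 : ‖y‖ ^ (1 + 1 / k : ℝ) ≤ ‖y‖ :=
      Real.rpow_le_self_of_le_one hy0.le hy1.le (by simp)
    rw [norm_mul, norm_mul, norm_pow, norm_pow]
    calc _ ≤ ‖b (j + 1)‖ * (δ * ‖y‖ ^ (j + 1)) * ‖y‖ ^ (d - (j + 1)) := by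
          gcongr
          exact (hxpow _ (by omega)).trans (by gcongr)
      _ = δ * ‖b (j + 1)‖ * ‖y‖ ^ (j + 1 + (d - (j + 1))) := by rw [pow_add]; ring
      _ = _ := by congr 2; omega
  have ha : ∀ i ∈ Finset.Icc k (d - 1), ‖a i * x ^ i * y ^ (d - 1 - i)‖ ≤
      δ * ‖a i‖ * ‖y‖ ^ d := by
    intro i hi
    obtain ⟨hi1, hi2⟩ := Finset.mem_Icc.mp hi
    have h1 : (‖y‖ ^ (1 + 1 / k : ℝ)) ^ i ≤ ‖y‖ ^ (i + 1) := by
      rw [← Real.rpow_mul_natCast hy0.le, ← Real.rpow_natCast]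
      apply Real.rpow_le_rpow_of_exponent_ge hy0 hy1.le
      have : (k : ℝ) ≤ i := by exact_mod_cast hi1
      have : 1 ≤ 1 / k * (i : ℝ) := by
        rw [div_mul_eq_mul_div, one_mul, one_le_div hk0]; exact this
      push_cast
      linarith
    rw [norm_mul, norm_mul, norm_pow, norm_pow]
    calc _ ≤ ‖a i‖ * (δ * ‖y‖ ^ (i + 1)) * ‖y‖ ^ (d - 1 - i) := by
          gcongr
          exact (hxpow _ (by omega)).trans (by gcongr)
      _ = δ * ‖a i‖ * ‖y‖ ^ (i + 1 + (d - 1 - i)) := by rw [pow_add]; ring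
      _ = _ := by congr 2; omega
  have hsplit : ∑ i ∈ Finset.Icc k (d - 1), a i * x ^ i * y ^ (d - 1 - i) +
        ∑ j ∈ Finset.range (d + 1), b j * x ^ j * y ^ (d - j) - b 0 * y ^ d =
      ∑ i ∈ Finset.Icc k (d - 1), a i * x ^ i * y ^ (d - 1 - i) +
        ∑ j ∈ Finset.range d, b (j + 1) * x ^ (j + 1) * y ^ (d - (j + 1)) := by
    rw [Finset.sum_range_succ']; simp; ring
  rw [hsplit]
  refine (norm_add_le _ _).trans ((add_le_add (norm_sum_le_of_le _ ha)
    (norm_sum_le_of_le _ hb)).trans_eq ?_)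
  rw [← Finset.sum_mul, ← Finset.sum_mul, ← Finset.mul_sum, ← Finset.mul_sum]
  ring

lemma lt_of_integrableOn {d k : ℕ} (hd : 1 ≤ d) (hk : 1 ≤ k) (a b : ℕ → ℂ) (hb : b 0 ≠ 0)
    {F : ℂ × ℂ → ℂ} (hF : ∀ x y, F (x, y) = ∑ i ∈ Finset.Icc k (d - 1), a i * x ^ i * y ^ (d - 1 - i) +
      ∑ j ∈ Finset.range (d + 1), b j * x ^ j * y ^ (d - j)) (hFc : Continuous F)
    {c ε : ℝ} (hc : 0 ≤ c) (hε : 0 < ε)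
    (hint : IntegrableOn (fun p : ℂ × ℂ => ‖F p‖ ^ (-2 * c)) (Metric.ball 0 ε)) :
    c < (2 * k + 1) / (k * d) := by
  set M := ∑ i ∈ Finset.Icc k (d - 1), ‖a i‖ + ∑ j ∈ Finset.range d, ‖b (j + 1)‖
  have hM : 0 ≤ M := by positivity
  have hb0 : 0 < ‖b 0‖ := norm_pos_iff.mpr hb
  have hk0 : (0 : ℝ) < k := by exact_mod_cast hk
  have hd0 : (0 : ℝ) < d := by exact_mod_cast hd
  set δ := ‖b 0‖ / (2 * (M + ‖b 0‖)) with hδ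
  have hδ0 : 0 < δ := by positivity
  have hδ1 : δ ≤ 1 := by rw [hδ, div_le_one (by positivity)]; linarith
  have hδM : δ * M ≤ ‖b 0‖ / 2 := by
    rw [hδ, div_mul_eq_mul_div, div_le_div_iff₀ (by positivity) two_pos]
    nlinarith
  have := lt_of_integrableOn_ball hFc (d := d) (c := c) (δ := δ) (κ := 1 + 1 / k)
    (M := 2 * ‖b 0‖) hc hδ0 hδ1 (by simp) (by positivity) hε ?_ hint
  · rw [lt_div_iff₀ (by positivity)]
    have h1 : 2 * c * d * k - 2 * (k + 1) < 2 * k := by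
      have h2 := mul_lt_mul_of_pos_right this hk0
      have h3 : (1 / k : ℝ) * k = 1 := by field_simp
      linarith
    linarith
  · intro x y hy hy1 hx
    have h := norm_sub_monomial_le (d := d) hk a b hδ0.le hδ1 hy hy1 hx
    rw [← hF] at h
    have hyd : 0 < ‖y‖ ^ d := by positivity
    have h' : ‖F (x, y) - b 0 * y ^ d‖ ≤ ‖b 0‖ / 2 * ‖y‖ ^ d := h.trans (by gcongr)
    have hn : ‖b 0 * y ^ d‖ = ‖b 0‖ * ‖y‖ ^ d := by rw [norm_mul, norm_pow]
    have hpos : 0 < ‖b 0‖ * ‖y‖ ^ d := by positivity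
    constructor
    · intro h0
      rw [h0, zero_sub, norm_neg, hn] at h'
      linarith
    · have := norm_le_norm_add_norm_sub' (F (x, y)) (b 0 * y ^ d)
      linarith

theorem lct_mult_d_sub_one_no_line_component (d k : ℕ) (hd : 3 ≤ d) (hk : 2 ≤ k)
    (hkd : k ≤ d - 1) (hbig : 2 * k > d - 1) (a b : ℕ → ℂ)
    (ha : a k ≠ 0) (hb : b 0 ≠ 0)
    (f : MvPolynomial (Fin 2) ℂ)
    (hf : f = (∑ i ∈ Finset.Icc k (d - 1), C (a i) * X 0 ^ i * X 1 ^ (d - 1 - i)) +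
        ∑ j ∈ Finset.range (d + 1), C (b j) * X 0 ^ j * X 1 ^ (d - j))
    (hsf : Squarefree f) :
    lct₀ (evalFun f) = (2 * k + 1) / (k * d) := by
  have hF : ∀ x y, evalFun f (x, y) = ∑ i ∈ Finset.Icc k (d - 1), a i * x ^ i * y ^ (d - 1 - i) +
      ∑ j ∈ Finset.range (d + 1), b j * x ^ j * y ^ (d - j) := by
    intro x y
    simp [evalFun, hf]
  have hFc : Continuous (evalFun f) := by
    have : evalFun f = fun p => ∑ i ∈ Finset.Icc k (d - 1), a i * p.1 ^ i * p.2 ^ (d - 1 - i) +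
      ∑ j ∈ Finset.range (d + 1), b j * p.1 ^ j * p.2 ^ (d - j) := funext fun p => hF p.1 p.2
    rw [this]; fun_prop
  set P : Polynomial ℂ := ∑ i ∈ Finset.Icc k (d - 1), Polynomial.C (a i) * Polynomial.X ^ i
  set Q : Polynomial ℂ := ∑ j ∈ Finset.range (d + 1), Polynomial.C (b j) * Polynomial.X ^ j
  set P' : Polynomial ℂ :=
    ∑ i ∈ Finset.Icc k (d - 1), Polynomial.C (a i) * Polynomial.X ^ (d - 1 - i)
  set Q' : Polynomial ℂ := ∑ j ∈ Finset.range (d + 1), Polynomial.C (b j) * Polynomial.X ^ (d - j)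
  set R : Polynomial ℂ := ∑ i ∈ Finset.Icc k (d - 1), Polynomial.C (a i) * Polynomial.X ^ (i - k)
  have hkmem : k ∈ Finset.Icc k (d - 1) := by simp [hkd]
  have hPk : P.coeff k ≠ 0 := by
    simpa [P, Polynomial.finsetSum_coeff, Polynomial.coeff_C_mul, Polynomial.coeff_X_pow,
      hkd] using ha
  have hQ0 : Q.coeff 0 ≠ 0 := by
    simp only [Q, Polynomial.finsetSum_coeff, Polynomial.coeff_C_mul, Polynomial.coeff_X_pow]
    rw [Finset.sum_eq_single 0 (fun j _ hj => by simp [hj.symm]) (by simp)]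
    simpa using hb
  have hP'k : P'.coeff (d - 1 - k) ≠ 0 := by
    simp only [P', Polynomial.finsetSum_coeff, Polynomial.coeff_C_mul, Polynomial.coeff_X_pow]
    rw [Finset.sum_eq_single k _ (fun h => absurd hkmem h)]
    · simpa using ha
    · intro i hi hik
      have := Finset.mem_Icc.mp hi
      rw [if_neg (by omega), mul_zero]
  have hQ'd : Q'.coeff d ≠ 0 := by
    simp only [Q', Polynomial.finsetSum_coeff, Polynomial.coeff_C_mul, Polynomial.coeff_X_pow]
    rw [Finset.sum_eq_single 0 _ (by simp)]
    · simpa using hb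
    · intro j hj hj0
      have := Finset.mem_range.mp hj
      rw [if_neg (by omega), mul_zero]
  have ne_of_coeff : ∀ {S : Polynomial ℂ} {n : ℕ}, S.coeff n ≠ 0 → S ≠ 0 := by
    rintro S n h rfl; simp at h
  have hPdeg : P.natDegree ≤ d - 1 := Polynomial.natDegree_sum_le_of_forall_le _ _ fun i hi =>
    (Polynomial.natDegree_C_mul_X_pow_le _ _).trans (Finset.mem_Icc.mp hi).2
  have hQdeg : Q.natDegree ≤ d := Polynomial.natDegree_sum_le_of_forall_le _ _ fun j hj =>
    (Polynomial.natDegree_C_mul_X_pow_le _ _).trans (by simpa [Nat.lt_succ_iff] using hj)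
  have hP'deg : P'.natDegree ≤ d - 1 - k := Polynomial.natDegree_sum_le_of_forall_le _ _ fun i hi =>
    (Polynomial.natDegree_C_mul_X_pow_le _ _).trans (by have := Finset.mem_Icc.mp hi; omega)
  have hQ'deg : Q'.natDegree ≤ d := Polynomial.natDegree_sum_le_of_forall_le _ _ fun j hj =>
    (Polynomial.natDegree_C_mul_X_pow_le _ _).trans (by omega)
  have hRdeg : R.natDegree ≤ d - 1 - k := Polynomial.natDegree_sum_le_of_forall_le _ _ fun i hi =>
    (Polynomial.natDegree_C_mul_X_pow_le _ _).trans (by have := Finset.mem_Icc.mp hi; omega)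
  have hPR : P = Polynomial.X ^ k * R := by
    simp only [P, R, Finset.mul_sum]
    refine Finset.sum_congr rfl fun i hi => ?_
    rw [mul_left_comm, ← pow_add, Nat.add_sub_cancel' (Finset.mem_Icc.mp hi).1]
  have hord : ∀ u, (P.rootMultiplicity u ≤ k ∧ Q.rootMultiplicity u = 0) ∨
      P.rootMultiplicity u + k + 1 ≤ d := by
    intro u
    rcases eq_or_ne u 0 with rfl | hu
    · left
      rw [Polynomial.rootMultiplicity_eq_natTrailingDegree']
      refine ⟨Polynomial.natTrailingDegree_le_of_ne_zero hPk, Polynomial.rootMultiplicity_eq_zero ?_⟩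
      rwa [Polynomial.IsRoot, ← Polynomial.coeff_zero_eq_eval_zero]
    · right
      have h1 : P.rootMultiplicity u = R.rootMultiplicity u := by
        rw [hPR, Polynomial.rootMultiplicity_mul (hPR ▸ ne_of_coeff hPk),
          Polynomial.rootMultiplicity_eq_zero (p := Polynomial.X ^ k) (by simp [hu]), zero_add]
      have := rootMultiplicity_le_natDegree R u
      omega
  have hord' : ∀ u, P'.rootMultiplicity u + k + 1 ≤ d := by
    intro u
    have := rootMultiplicity_le_natDegree P' u
    omega
  have hf₁ : aeval ![X 0, X 1] (P.homogenize (d - 1)) + aeval ![X 0, X 1] (Q.homogenize d) = f := by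
    rw [hf]
    simp only [P, Q, Polynomial.homogenize_finsetSum, Polynomial.homogenize_C_mul, map_sum]
    congr 1
    · refine Finset.sum_congr rfl fun i hi => ?_
      rw [Polynomial.homogenize_X_pow (Finset.mem_Icc.mp hi).2]
      simp [mul_assoc, algebraMap_eq]
    · refine Finset.sum_congr rfl fun j hj => ?_
      rw [Polynomial.homogenize_X_pow (Nat.lt_succ_iff.mp (Finset.mem_range.mp hj))]
      simp [mul_assoc, algebraMap_eq]
  have hf₂ : aeval ![X 1, X 0] (P'.homogenize (d - 1)) + aeval ![X 1, X 0] (Q'.homogenize d) = f := by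
    rw [hf]
    simp only [P', Q', Polynomial.homogenize_finsetSum, Polynomial.homogenize_C_mul, map_sum]
    congr 1
    · refine Finset.sum_congr rfl fun i hi => ?_
      rw [Polynomial.homogenize_X_pow (by omega), Nat.sub_sub_self (Finset.mem_Icc.mp hi).2]
      simp [mul_assoc, mul_comm, algebraMap_eq]
    · refine Finset.sum_congr rfl fun j hj => ?_
      rw [Polynomial.homogenize_X_pow (by omega),
        Nat.sub_sub_self (Nat.lt_succ_iff.mp (Finset.mem_range.mp hj))]
      simp [mul_assoc, mul_comm, algebraMap_eq]
  have hsq := not_sq_dvd_of_squarefree_homogenize (by omega) (by omega) hPdeg hQdeg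
    (by simp) (by simp) (hf₁.symm ▸ hsf)
  have hsq' := not_sq_dvd_of_squarefree_homogenize (by omega) (by omega)
    (hP'deg.trans (Nat.sub_le _ _)) hQ'deg (by simp) (by simp) (hf₂.symm ▸ hsf)
  have hchart : ∀ u y, evalFun f (y * u, y) = y ^ (d - 1) * (P.eval u + y * Q.eval u) := by
    intro u y
    simp only [hF, P, Q, Polynomial.eval_finsetSum, mul_add, Finset.mul_sum]
    congr 1
    · refine Finset.sum_congr rfl fun i hi => ?_
      obtain ⟨l, hl⟩ := Nat.exists_eq_add_of_le (Finset.mem_Icc.mp hi).2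
      rw [hl, Nat.add_sub_cancel_left]
      simp only [Polynomial.eval_mul, Polynomial.eval_C, Polynomial.eval_pow, Polynomial.eval_X]
      ring
    · refine Finset.sum_congr rfl fun j hj => ?_
      obtain ⟨l, hl⟩ := Nat.exists_eq_add_of_le (Nat.lt_succ_iff.mp (Finset.mem_range.mp hj))
      rw [← mul_assoc, ← pow_succ, Nat.sub_add_cancel (by omega), hl, Nat.add_sub_cancel_left]
      simp only [Polynomial.eval_mul, Polynomial.eval_C, Polynomial.eval_pow, Polynomial.eval_X]
      ring
  have hchart' : ∀ u x, evalFun f (x, x * u) = x ^ (d - 1) * (P'.eval u + x * Q'.eval u) := by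
    intro u x
    simp only [hF, P', Q', Polynomial.eval_finsetSum, mul_add, Finset.mul_sum]
    congr 1
    · refine Finset.sum_congr rfl fun i hi => ?_
      obtain ⟨l, hl⟩ := Nat.exists_eq_add_of_le (Finset.mem_Icc.mp hi).2
      rw [hl, Nat.add_sub_cancel_left]
      simp only [Polynomial.eval_mul, Polynomial.eval_C, Polynomial.eval_pow, Polynomial.eval_X]
      ring
    · refine Finset.sum_congr rfl fun j hj => ?_
      obtain ⟨l, hl⟩ := Nat.exists_eq_add_of_le (Nat.lt_succ_iff.mp (Finset.mem_range.mp hj))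
      rw [← mul_assoc, ← pow_succ, Nat.sub_add_cancel (by omega), hl, Nat.add_sub_cancel_left]
      simp only [Polynomial.eval_mul, Polynomial.eval_C, Polynomial.eval_pow, Polynomial.eval_X]
      ring
  have hd0 : (0 : ℝ) < d := by exact_mod_cast (by omega : 0 < d)
  have hk0 : (0 : ℝ) < k := by exact_mod_cast (by omega : 0 < k)
  have hmem : ∀ c : ℝ, 2 / d < c → c < (2 * k + 1) / (k * d) →
      c ∈ { c : ℝ | 0 ≤ c ∧ ∃ ε : ℝ, 0 < ε ∧ IntegrableOn
        (fun p : ℂ × ℂ => ‖evalFun f p‖ ^ (-2 * c)) (Metric.ball (0 : ℂ × ℂ) ε) volume } := by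
    intro c hc1 hc2
    refine ⟨le_trans (by positivity) hc1.le, 1, one_pos, ?_⟩
    exact integrableOn_of_charts hd hk (by omega) ((div_lt_iff₀ hd0).mp hc1)
      ((lt_div_iff₀ (by positivity)).mp hc2) (ne_of_coeff hPk) (ne_of_coeff hQ0)
      (ne_of_coeff hP'k) (ne_of_coeff hQ'd) hord hord' hsq hsq' hFc hchart hchart'
  have hlt : (2 / d : ℝ) < (2 * k + 1) / (k * d) := by
    rw [div_lt_div_iff₀ hd0 (by positivity)]
    nlinarith
  refine IsLUB.csSup_eq ⟨?_, fun B hB => ?_⟩ ?_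
  · rintro c ⟨hc, ε, hε, hint⟩
    exact (lt_of_integrableOn (by omega) (by omega) a b hb hF hFc hc hε hint).le
  · by_contra! h
    obtain ⟨c, hc1, hc2⟩ := exists_between (max_lt h hlt)
    exact absurd (hB (hmem c ((le_max_right _ _).trans_lt hc1) hc2))
      (not_le.mpr ((le_max_left _ _).trans_lt hc1))
  · obtain ⟨c, hc1, hc2⟩ := exists_between hlt
    exact ⟨c, hmem c hc1 hc2⟩
end

section
/- Let d ≥ 3 be an integer and let f ∈ ℂ[x,y] be a square-free polynomial of total degree d whose homogeneous components of degree less than d-1 vanish and whose homogeneous component f_{d-1} of degree d-1 is nonzero (so the curve V(f) has multiplicity d-1 at the origin). Then lct₀(f) < 2/(d-1) if and only if there exist a nonzero linear form ℓ ∈ ℂ[x,y] and an integer m with 2m > d-1 such that ℓ^m divides f_{d-1}. -/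
open MeasureTheory MvPolynomial

theorem norm_taylor_coeff_mul_pow_le_of_prod (S : Multiset ℂ) (s : ℂ) (ρ : ℝ) (hρ : 0 ≤ ρ)
    (h : ∀ r ∈ S, ρ ≤ ‖s - r‖) (m : ℕ) :
    ‖(Polynomial.taylor s (S.map fun r => Polynomial.X - Polynomial.C r).prod).coeff m‖ * ρ ^ m ≤
      2 ^ S.card * ‖((S.map fun r => Polynomial.X - Polynomial.C r).prod).eval s‖ := by
  induction S using Multiset.induction_on generalizing m with
  | empty =>
    rcases m with _ | m <;> simp [Polynomial.coeff_one]
  | cons r S ih =>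
    have ih' := ih fun r hr => h r (Multiset.mem_cons_of_mem hr)
    have hr := h r (Multiset.mem_cons_self r S)
    simp only [Multiset.map_cons, Multiset.prod_cons, Multiset.card_cons, Polynomial.taylor_mul,
      Polynomial.eval_mul, Polynomial.eval_sub, Polynomial.eval_X, Polynomial.eval_C, map_sub,
      Polynomial.taylor_X, Polynomial.taylor_C, norm_mul]
    set Q := (S.map fun r => Polynomial.X - Polynomial.C r).prod with hQ
    have e : (Polynomial.X + Polynomial.C s - Polynomial.C r) * Polynomial.taylor s Q
        = Polynomial.X * Polynomial.taylor s Q + Polynomial.C (s - r) * Polynomial.taylor s Q := by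
      rw [map_sub]; ring
    rw [e, Polynomial.coeff_add, Polynomial.coeff_C_mul]
    rcases m with _ | m
    · have := ih' 0
      simp only [Polynomial.coeff_X_mul_zero, zero_add, pow_zero, mul_one, norm_mul] at this ⊢
      calc _ ≤ ‖s - r‖ * (2 ^ S.card * ‖Q.eval s‖) := by gcongr
        _ ≤ _ := by
          rw [pow_succ]
          nlinarith [mul_nonneg (mul_nonneg (norm_nonneg (s - r)) (norm_nonneg (Q.eval s)))
            (pow_nonneg (zero_le_two (α := ℝ)) S.card)]
    · rw [Polynomial.coeff_X_mul]
      have h1 := ih' m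
      have h2 := ih' (m + 1)
      have h3 := norm_add_le ((Polynomial.taylor s Q).coeff m)
        ((s - r) * (Polynomial.taylor s Q).coeff (m + 1))
      rw [norm_mul] at h3
      set E := 2 ^ S.card * ‖Q.eval s‖ with hE
      have hE0 : 0 ≤ E := by positivity
      calc _ ≤ (‖(Polynomial.taylor s Q).coeff m‖ + ‖s - r‖ *
              ‖(Polynomial.taylor s Q).coeff (m + 1)‖) * ρ ^ (m + 1) := by gcongr
        _ = (‖(Polynomial.taylor s Q).coeff m‖ * ρ ^ m) * ρ + ‖s - r‖ *
              (‖(Polynomial.taylor s Q).coeff (m + 1)‖ * ρ ^ (m + 1)) := by ring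
        _ ≤ E * ‖s - r‖ + ‖s - r‖ * E := by gcongr
        _ = _ := by rw [hE]; ring

theorem norm_taylor_coeff_mul_pow_le (P : Polynomial ℂ) (s : ℂ) (ρ : ℝ) (hρ : 0 ≤ ρ)
    (h : ∀ r ∈ P.roots, ρ ≤ ‖s - r‖) (m : ℕ) :
    ‖(Polynomial.taylor s P).coeff m‖ * ρ ^ m ≤ 2 ^ P.natDegree * ‖P.eval s‖ := by
  have hs := IsAlgClosed.splits P
  have hP := hs.eq_prod_roots
  have hcard := hs.natDegree_eq_card_roots
  have key := norm_taylor_coeff_mul_pow_le_of_prod P.roots s ρ hρ h m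
  set Q := (P.roots.map fun r => Polynomial.X - Polynomial.C r).prod with hQ
  rw [hcard, hP]
  simp only [Polynomial.taylor_mul, Polynomial.taylor_C, Polynomial.coeff_C_mul, norm_mul,
    Polynomial.eval_mul, Polynomial.eval_C]
  calc _ = ‖P.leadingCoeff‖ * (‖(Polynomial.taylor s Q).coeff m‖ * ρ ^ m) := by ring
    _ ≤ ‖P.leadingCoeff‖ * (2 ^ P.roots.card * ‖Q.eval s‖) := by gcongr
    _ = _ := by rw [← hP]; ring

theorem norm_eval_rpow_neg_le (P : Polynomial ℂ) (s : ℂ) {D N m : ℕ} (hD : P.natDegree ≤ D)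
    (hmN : m ≤ N) {δ c : ℝ} (hδ : 0 < δ) (hc : 0 < c)
    (hm : δ ≤ ‖(Polynomial.taylor s P).coeff m‖) :
    ‖P.eval s‖ ^ (-2 * c) ≤ (δ / 2 ^ D) ^ (-2 * c) *
      (1 + ∑ r ∈ P.roots.toFinset, ‖s - r‖ ^ (-(2 * c * N))) := by
  have hsum : 0 ≤ ∑ r ∈ P.roots.toFinset, ‖s - r‖ ^ (-(2 * c * N)) :=
    Finset.sum_nonneg fun r _ => by positivity
  by_cases h0 : P.eval s = 0
  · rw [h0, norm_zero, Real.zero_rpow (by linarith)]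
    positivity
  obtain ⟨ρ, hρ, hρ1, hρr, hρs⟩ : ∃ ρ : ℝ, 0 < ρ ∧ ρ ≤ 1 ∧ (∀ r ∈ P.roots, ρ ≤ ‖s - r‖) ∧
      ρ ^ (-(2 * c * N)) ≤ 1 + ∑ r ∈ P.roots.toFinset, ‖s - r‖ ^ (-(2 * c * N)) := by
    by_cases hne : P.roots.toFinset.Nonempty
    · obtain ⟨r, hr, hmin⟩ := P.roots.toFinset.exists_min_image (fun r => ‖s - r‖) hne
      have hsr : 0 < ‖s - r‖ := by
        rw [norm_pos_iff, sub_ne_zero]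
        rintro rfl
        exact h0 (Polynomial.isRoot_of_mem_roots (Multiset.mem_toFinset.1 hr))
      refine ⟨min 1 ‖s - r‖, lt_min one_pos hsr, min_le_left _ _, fun r' hr' =>
        (min_le_right _ _).trans (hmin r' (Multiset.mem_toFinset.2 hr')), ?_⟩
      have hsingle := Finset.single_le_sum (f := fun r => ‖s - r‖ ^ (-(2 * c * N)))
        (fun r _ => by positivity) hr
      rcases min_cases 1 ‖s - r‖ with h | h <;> rw [h.1]
      · rw [Real.one_rpow]; linarith
      · linarith
    · refine ⟨1, one_pos, le_rfl, fun r hr => (hne ⟨r, Multiset.mem_toFinset.2 hr⟩).elim, ?_⟩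
      rw [Real.one_rpow]; linarith
  have key := norm_taylor_coeff_mul_pow_le P s ρ hρ.le hρr m
  have h1 : δ / 2 ^ D * ρ ^ N ≤ ‖P.eval s‖ := by
    rw [div_mul_eq_mul_div, div_le_iff₀ (by positivity)]
    calc δ * ρ ^ N ≤ ‖(Polynomial.taylor s P).coeff m‖ * ρ ^ m :=
          mul_le_mul hm (pow_le_pow_of_le_one hρ.le hρ1 hmN) (by positivity) (by positivity)
      _ ≤ 2 ^ P.natDegree * ‖P.eval s‖ := key
      _ ≤ 2 ^ D * ‖P.eval s‖ := by gcongr; norm_num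
      _ = _ := mul_comm _ _
  calc _ ≤ (δ / 2 ^ D * ρ ^ N) ^ (-2 * c) :=
        Real.rpow_le_rpow_of_nonpos (by positivity) h1 (by linarith)
    _ = (δ / 2 ^ D) ^ (-2 * c) * ρ ^ (-(2 * c * N)) := by
        rw [Real.mul_rpow (by positivity) (by positivity), ← Real.rpow_natCast ρ,
          ← Real.rpow_mul hρ.le]
        congr 2; ring
    _ ≤ _ := by gcongr

theorem exists_lintegral_ball_norm_rpow_eq {a : ℝ} (ha : a < 2) :
    ∃ K : ℝ, 0 ≤ K ∧ ∀ R : ℝ, 0 < R → ∫⁻ x in Metric.ball (0 : ℂ) R, ENNReal.ofReal (‖x‖ ^ (-a)) =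
      ENNReal.ofReal (K * R ^ (2 - a)) := by
  refine ⟨∫ x in Metric.ball (0 : ℂ) 1, ‖x‖ ^ (-a), integral_nonneg fun x => by positivity,
    fun R hR => ?_⟩
  have hint : ∀ r : ℝ, IntegrableOn (fun x : ℂ => ‖x‖ ^ (-a)) (Metric.ball 0 r) := fun r =>
    integrableOn_ball_of_norm_le_rpow (C := 1) (α := a) (by simp [Complex.finrank_real_complex])
      (by simpa [Complex.finrank_real_complex] using ha)
      (Filter.Eventually.of_forall fun x => by
        rw [one_mul, Real.norm_of_nonneg (by positivity)])
      (measurable_norm.pow_const _).aestronglyMeasurable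
  rw [← ofReal_integral_eq_lintegral_ofReal (hint R)
    (Filter.Eventually.of_forall fun x => by positivity)]
  congr 1
  have h := Measure.setIntegral_comp_smul_of_pos (volume : Measure ℂ) (fun x : ℂ => ‖x‖ ^ (-a))
    (Metric.ball 0 1) hR
  rw [smul_unitBall_of_pos hR, Complex.finrank_real_complex] at h
  have h2 : ∀ x : ℂ, ‖R • x‖ ^ (-a) = R ^ (-a) * ‖x‖ ^ (-a) := fun x => by
    rw [norm_smul, Real.norm_of_nonneg hR.le, Real.mul_rpow hR.le (norm_nonneg _)]
  simp only [h2, integral_const_mul, smul_eq_mul] at h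
  rw [eq_comm, inv_mul_eq_iff_eq_mul₀ (by positivity)] at h
  rw [h, Real.rpow_sub hR, Real.rpow_neg hR.le, Real.rpow_two]
  field_simp

theorem exists_lintegral_closedBall_norm_sub_rpow_le {a : ℝ} (ha0 : 0 ≤ a) (ha : a < 2) :
    ∃ K : ℝ, 0 ≤ K ∧ ∀ R : ℝ, 0 < R → ∀ z : ℂ,
      ∫⁻ x in Metric.closedBall (0 : ℂ) R, ENNReal.ofReal (‖x - z‖ ^ (-a)) ≤
        ENNReal.ofReal (K * R ^ (2 - a)) := by
  obtain ⟨K, hK, h⟩ := exists_lintegral_ball_norm_rpow_eq ha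
  refine ⟨K + Real.pi, by positivity, fun R hR z => ?_⟩
  set g : ℂ → ENNReal := (Metric.ball (0 : ℂ) R).indicator fun x => ENNReal.ofReal (‖x‖ ^ (-a))
  have hg : Measurable g := by
    refine Measurable.indicator ?_ measurableSet_ball
    fun_prop
  have hle : ∀ x : ℂ, ENNReal.ofReal (‖x - z‖ ^ (-a)) ≤ g (x - z) + ENNReal.ofReal (R ^ (-a)) := by
    intro x
    by_cases hx : x - z ∈ Metric.ball (0 : ℂ) R
    · simp only [g, Set.indicator_of_mem hx]
      exact le_self_add
    · simp only [g, Set.indicator_of_notMem hx, zero_add]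
      refine ENNReal.ofReal_le_ofReal (Real.rpow_le_rpow_of_nonpos hR ?_ (by linarith))
      simpa using hx
  calc _ ≤ ∫⁻ x in Metric.closedBall (0 : ℂ) R, (g (x - z) + ENNReal.ofReal (R ^ (-a))) :=
        lintegral_mono hle
    _ = (∫⁻ x in Metric.closedBall (0 : ℂ) R, g (x - z)) +
          ENNReal.ofReal (R ^ (-a)) * volume (Metric.closedBall (0 : ℂ) R) := by
        rw [lintegral_add_right _ measurable_const, setLIntegral_const]
    _ ≤ (∫⁻ x, g (x - z)) + ENNReal.ofReal (R ^ (-a)) * volume (Metric.closedBall (0 : ℂ) R) := by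
        gcongr
        exact Measure.restrict_le_self
    _ = ENNReal.ofReal (K * R ^ (2 - a)) + ENNReal.ofReal (R ^ (-a) * (R ^ 2 * Real.pi)) := by
        rw [lintegral_sub_right_eq_self g z, lintegral_indicator measurableSet_ball, h R hR,
          Complex.volume_closedBall, ENNReal.ofReal_mul (p := R ^ (-a)) (by positivity),
          ENNReal.ofReal_mul (p := R ^ 2) (by positivity), ENNReal.ofReal_pow hR.le,
          ENNReal.ofReal_eq_coe_nnreal Real.pi_pos.le, NNReal.pi]
        rfl
    _ = _ := by
        rw [← ENNReal.ofReal_add (by positivity) (by positivity)]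
        congr 1
        rw [Real.rpow_sub hR, Real.rpow_neg hR.le, Real.rpow_two]
        field_simp

/-- For `f` of order at least `n` at the origin, the polynomial `s ↦ y⁻ⁿ f(ys, y)` of one variable,
i.e. the restriction of the strict transform of `f` to a line of the blowup chart. -/
noncomputable def chartPoly (f : MvPolynomial (Fin 2) ℂ) (n : ℕ) (y : ℂ) : Polynomial ℂ :=
  ∑ e ∈ f.support, Polynomial.C (coeff e f * y ^ (e 0 + e 1 - n)) * Polynomial.X ^ (e 0)

theorem natDegree_chartPoly_le (f : MvPolynomial (Fin 2) ℂ) (n : ℕ) (y : ℂ) :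
    (chartPoly f n y).natDegree ≤ f.totalDegree := by
  refine Polynomial.natDegree_sum_le_of_forall_le _ _ fun e he =>
    (Polynomial.natDegree_C_mul_X_pow_le _ _).trans ?_
  have := le_totalDegree he
  rw [Finsupp.sum_fintype _ _ (by simp), Fin.sum_univ_two] at this
  omega

theorem evalFun_eq_sum (f : MvPolynomial (Fin 2) ℂ) (p : ℂ × ℂ) :
    evalFun f p = ∑ e ∈ f.support, coeff e f * (p.1 ^ e 0 * p.2 ^ e 1) := by
  simp [evalFun, eval_eq', Fin.prod_univ_two]

theorem evalFun_eq_pow_mul_eval_chartPoly {f : MvPolynomial (Fin 2) ℂ} {n : ℕ}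
    (hf : ∀ e ∈ f.support, n ≤ e 0 + e 1) (s y : ℂ) :
    evalFun f (y * s, y) = y ^ n * (chartPoly f n y).eval s := by
  rw [evalFun_eq_sum, chartPoly, Polynomial.eval_finsetSum, Finset.mul_sum]
  refine Finset.sum_congr rfl fun e he => ?_
  have h : y ^ (e 0) * y ^ (e 1) = y ^ n * y ^ (e 0 + e 1 - n) := by
    rw [← pow_add, ← pow_add, Nat.add_sub_cancel' (hf e he)]
  simp only [Polynomial.eval_mul, Polynomial.eval_C, Polynomial.eval_pow, Polynomial.eval_X]
  calc _ = coeff e f * s ^ (e 0) * (y ^ (e 0) * y ^ (e 1)) := by ring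
    _ = _ := by rw [h]; ring

theorem chartPoly_zero {f : MvPolynomial (Fin 2) ℂ} {n : ℕ}
    (hf : ∀ e ∈ f.support, n ≤ e 0 + e 1) :
    chartPoly f n 0 = aeval ![Polynomial.X, 1] (homogeneousComponent n f) := by
  rw [homogeneousComponent_apply, map_sum, Finset.sum_filter, chartPoly]
  refine Finset.sum_congr rfl fun e he => ?_
  have hdeg : e.degree = e 0 + e 1 := by
    rw [Finsupp.degree_eq_sum, Fin.sum_univ_two]
  rw [hdeg]
  split_ifs with h
  · rw [aeval_monomial, Finsupp.prod_fintype _ _ (by simp), Fin.prod_univ_two, h]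
    simp [Polynomial.C_eq_algebraMap]
  · have : e 0 + e 1 - n ≠ 0 := by have := hf e he; omega
    simp [this]

theorem continuous_taylor_chartPoly_coeff (f : MvPolynomial (Fin 2) ℂ) (n m : ℕ) :
    Continuous fun q : ℂ × ℂ => (Polynomial.taylor q.2 (chartPoly f n q.1)).coeff m := by
  have h : ∀ q : ℂ × ℂ, (Polynomial.taylor q.2 (chartPoly f n q.1)).coeff m =
      ∑ e ∈ f.support, coeff e f * q.1 ^ (e 0 + e 1 - n) * (q.2 ^ (e 0 - m) * (e 0).choose m) := by
    intro q
    rw [chartPoly, map_sum, Polynomial.finsetSum_coeff]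
    refine Finset.sum_congr rfl fun e _ => ?_
    rw [Polynomial.taylor_mul, Polynomial.taylor_C, Polynomial.coeff_C_mul,
      Polynomial.taylor_X_pow, Polynomial.coeff_X_add_C_pow]
  simp only [h]
  fun_prop

theorem exists_taylor_chartPoly_coeff_lower_bound {f : MvPolynomial (Fin 2) ℂ} {n N : ℕ}
    (h : ∀ s : ℂ, ∃ m ≤ N, (Polynomial.taylor s (chartPoly f n 0)).coeff m ≠ 0) :
    ∃ ε > (0 : ℝ), ∃ δ > (0 : ℝ), ∀ y s : ℂ, ‖y‖ < ε → ‖s‖ ≤ 1 →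
      ∃ m ≤ N, δ ≤ ‖(Polynomial.taylor s (chartPoly f n y)).coeff m‖ := by
  set G : ℂ × ℂ → ℝ := fun q =>
    ∑ m ∈ Finset.range (N + 1), ‖(Polynomial.taylor q.2 (chartPoly f n q.1)).coeff m‖ with hG
  have hGc : Continuous G := continuous_finsetSum _ fun m _ =>
    (continuous_taylor_chartPoly_coeff f n m).norm
  have hG0 : ∀ s, 0 < G (0, s) := fun s => by
    obtain ⟨m, hm, hne⟩ := h s
    exact Finset.sum_pos' (fun _ _ => norm_nonneg _)
      ⟨m, Finset.mem_range.2 (Nat.lt_succ_of_le hm), norm_pos_iff.2 hne⟩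
  obtain ⟨s₀, -, hs₀⟩ := (isCompact_closedBall (0 : ℂ) 1).exists_isMinOn
    (Metric.nonempty_closedBall.2 zero_le_one)
    (f := fun s => G (0, s)) (by fun_prop)
  obtain ⟨U, V, hU, -, h0U, hV, hUV⟩ := generalized_tube_lemma (isCompact_singleton (x := (0 : ℂ)))
    (isCompact_closedBall (0 : ℂ) 1) (n := {q | G (0, s₀) / 2 < G q})
    (isOpen_lt continuous_const hGc) (by
      rintro ⟨y, s⟩ ⟨hy, hs⟩
      obtain rfl : y = 0 := hy
      have h1 : G (0, s₀) ≤ G (0, s) := hs₀ hs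
      have h2 := hG0 s₀
      change G (0, s₀) / 2 < G (0, s)
      linarith)
  obtain ⟨ε, hε, hball⟩ := Metric.isOpen_iff.1 hU 0 (h0U rfl)
  have hδ := hG0 s₀
  refine ⟨ε, hε, G (0, s₀) / 2 / (N + 1), by positivity, fun y s hy hs => ?_⟩
  have hmem : G (0, s₀) / 2 < G (y, s) :=
    hUV ⟨hball (by simpa using hy), hV (by simpa using hs)⟩
  by_contra! hcon
  have : G (y, s) ≤ ∑ m ∈ Finset.range (N + 1), G (0, s₀) / 2 / (N + 1) :=
    Finset.sum_le_sum fun m hm => (hcon m (Nat.lt_succ_iff.1 (Finset.mem_range.1 hm))).le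
  rw [Finset.sum_const, Finset.card_range, nsmul_eq_mul] at this
  push_cast at this
  rw [mul_div_cancel₀ _ (by positivity)] at this
  linarith

theorem continuous_evalFun (f : MvPolynomial (Fin 2) ℂ) : Continuous (evalFun f) := by
  simp only [funext (evalFun_eq_sum f)]
  fun_prop

theorem exists_lintegral_slice_evalFun_le {f : MvPolynomial (Fin 2) ℂ} {n N : ℕ}
    (hf : ∀ e ∈ f.support, n ≤ e 0 + e 1)
    (h : ∀ s : ℂ, ∃ m ≤ N, (Polynomial.taylor s (chartPoly f n 0)).coeff m ≠ 0)
    {c : ℝ} (hc : 0 < c) (hcN : c * N < 1) :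
    ∃ ε > (0 : ℝ), ∃ K : ℝ, ∀ y : ℂ, y ≠ 0 → ‖y‖ < ε →
      ∫⁻ x in Metric.closedBall 0 ‖y‖, ENNReal.ofReal (‖evalFun f (x, y)‖ ^ (-2 * c)) ≤
        ENNReal.ofReal (K * ‖y‖ ^ (-(2 * c * n - 2))) := by
  obtain ⟨ε, hε, δ, hδ, hlow⟩ := exists_taylor_chartPoly_coeff_lower_bound h
  set a : ℝ := 2 * c * N with ha
  obtain ⟨K, hK, hKR⟩ := exists_lintegral_closedBall_norm_sub_rpow_le (a := a) (by positivity)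
    (by rw [ha]; linarith)
  set D := f.totalDegree
  set B := (δ / 2 ^ D) ^ (-2 * c) with hB
  have hB0 : 0 ≤ B := by positivity
  refine ⟨ε, hε, B * (Real.pi + D * K), fun y hy hyε => ?_⟩
  have hy0 : 0 < ‖y‖ := norm_pos_iff.2 hy
  set P := chartPoly f n y with hP
  have hpt : ∀ x ∈ Metric.closedBall (0 : ℂ) ‖y‖,
      ENNReal.ofReal (‖evalFun f (x, y)‖ ^ (-2 * c)) ≤
      ENNReal.ofReal (‖y‖ ^ (-(2 * c * n)) * B) * (1 + ∑ r ∈ P.roots.toFinset,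
        ENNReal.ofReal (‖y‖ ^ a) * ENNReal.ofReal (‖x - y * r‖ ^ (-a))) := by
    intro x hx
    obtain ⟨m, hmN, hm⟩ := hlow y (x / y) hyε (by
      rw [norm_div, div_le_one hy0]; simpa using hx)
    have h1 := norm_eval_rpow_neg_le P (x / y) (natDegree_chartPoly_le f n y) hmN hδ hc hm
    have h2 : evalFun f (x, y) = y ^ n * P.eval (x / y) := by
      rw [← evalFun_eq_pow_mul_eval_chartPoly hf, mul_div_cancel₀ _ hy]
    have h3 : ∀ r : ℂ, ‖x / y - r‖ ^ (-a) = ‖y‖ ^ a * ‖x - y * r‖ ^ (-a) := fun r => by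
      have : x / y - r = (x - y * r) / y := by field_simp
      rw [this, norm_div, Real.div_rpow (norm_nonneg _) (norm_nonneg _), Real.rpow_neg hy0.le a,
        div_inv_eq_mul, mul_comm]
    have h4 : (‖y‖ ^ n) ^ (-2 * c) = ‖y‖ ^ (-(2 * c * n)) := by
      rw [← Real.rpow_natCast, ← Real.rpow_mul hy0.le]
      congr 1; ring
    have h5 : ∀ r : ℂ, ENNReal.ofReal (‖y‖ ^ a) * ENNReal.ofReal (‖x - y * r‖ ^ (-a)) =
        ENNReal.ofReal (‖x / y - r‖ ^ (-a)) := fun r => by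
      rw [h3, ENNReal.ofReal_mul (by positivity)]
    simp only [h5]
    rw [← ENNReal.ofReal_sum_of_nonneg (fun _ _ => by positivity), ← ENNReal.ofReal_one,
      ← ENNReal.ofReal_add zero_le_one (Finset.sum_nonneg fun _ _ => by positivity),
      ← ENNReal.ofReal_mul (by positivity)]
    refine ENNReal.ofReal_le_ofReal ?_
    rw [h2, norm_mul, norm_pow, Real.mul_rpow (by positivity) (by positivity), h4, mul_assoc _ B]
    exact mul_le_mul_of_nonneg_left h1 (by positivity)
  have hroots : (P.roots.toFinset.card : ℝ) ≤ D := by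
    exact_mod_cast (P.roots.toFinset_card_le.trans (Polynomial.card_roots' P)).trans
      (natDegree_chartPoly_le f n y)
  have hmeas : ∀ r : ℂ, Measurable fun x : ℂ => ENNReal.ofReal (‖x - y * r‖ ^ (-a)) :=
    fun r => by fun_prop
  calc _ ≤ ∫⁻ x in Metric.closedBall 0 ‖y‖, ENNReal.ofReal (‖y‖ ^ (-(2 * c * n)) * B) *
        (1 + ∑ r ∈ P.roots.toFinset,
          ENNReal.ofReal (‖y‖ ^ a) * ENNReal.ofReal (‖x - y * r‖ ^ (-a))) :=
        setLIntegral_mono' measurableSet_closedBall hpt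
    _ = ENNReal.ofReal (‖y‖ ^ (-(2 * c * n)) * B) * (volume (Metric.closedBall (0 : ℂ) ‖y‖) +
          ∑ r ∈ P.roots.toFinset, ENNReal.ofReal (‖y‖ ^ a) *
            ∫⁻ x in Metric.closedBall 0 ‖y‖, ENNReal.ofReal (‖x - y * r‖ ^ (-a))) := by
        rw [lintegral_const_mul _ (by fun_prop), lintegral_add_left measurable_const,
          setLIntegral_one, lintegral_finsetSum _ (by fun_prop)]
        congr 3 with r
        rw [lintegral_const_mul _ (hmeas r)]
    _ ≤ ENNReal.ofReal (‖y‖ ^ (-(2 * c * n)) * B) * (ENNReal.ofReal (‖y‖ ^ 2 * Real.pi) +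
          ∑ r ∈ P.roots.toFinset, ENNReal.ofReal (‖y‖ ^ a) *
            ENNReal.ofReal (K * ‖y‖ ^ (2 - a))) := by
        gcongr with r
        · rw [Complex.volume_closedBall, ENNReal.ofReal_mul (by positivity),
            ENNReal.ofReal_pow hy0.le, ENNReal.ofReal_eq_coe_nnreal Real.pi_pos.le]
          exact le_rfl
        · exact hKR _ hy0 _
    _ = ENNReal.ofReal (‖y‖ ^ (-(2 * c * n)) * B * (‖y‖ ^ 2 * Real.pi +
          P.roots.toFinset.card * (‖y‖ ^ a * (K * ‖y‖ ^ (2 - a))))) := by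
        rw [Finset.sum_const, nsmul_eq_mul, ← ENNReal.ofReal_mul (by positivity),
          ← ENNReal.ofReal_natCast, ← ENNReal.ofReal_mul (by positivity),
          ← ENNReal.ofReal_add (by positivity) (by positivity),
          ← ENNReal.ofReal_mul (by positivity)]
    _ ≤ _ := by
        refine ENNReal.ofReal_le_ofReal ?_
        have e1 : ‖y‖ ^ a * (K * ‖y‖ ^ (2 - a)) = K * ‖y‖ ^ 2 := by
          rw [mul_left_comm, ← Real.rpow_add hy0, add_sub_cancel, Real.rpow_two]
        have e2 : ‖y‖ ^ (-(2 * c * n - 2)) = ‖y‖ ^ (-(2 * c * n)) * ‖y‖ ^ 2 := by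
          rw [← Real.rpow_two, ← Real.rpow_add hy0]; congr 1; ring
        rw [e1, e2]
        calc _ = B * (Real.pi + P.roots.toFinset.card * K) * (‖y‖ ^ (-(2 * c * n)) * ‖y‖ ^ 2) := by
              ring
          _ ≤ _ := by gcongr

theorem exists_lintegral_chart_evalFun_lt_top {f : MvPolynomial (Fin 2) ℂ} {n N : ℕ}
    (hf : ∀ e ∈ f.support, n ≤ e 0 + e 1)
    (h : ∀ s : ℂ, ∃ m ≤ N, (Polynomial.taylor s (chartPoly f n 0)).coeff m ≠ 0)
    {c : ℝ} (hc : 0 < c) (hcN : c * N < 1) (hcn : c * n < 2) :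
    ∃ ε > (0 : ℝ), ∫⁻ p in {p : ℂ × ℂ | ‖p.1‖ ≤ ‖p.2‖ ∧ ‖p.2‖ < ε},
      ENNReal.ofReal (‖evalFun f p‖ ^ (-2 * c)) < ⊤ := by
  obtain ⟨ε, hε, K, hK⟩ := exists_lintegral_slice_evalFun_le hf h hc hcN
  refine ⟨ε, hε, ?_⟩
  have hS : MeasurableSet {p : ℂ × ℂ | ‖p.1‖ ≤ ‖p.2‖ ∧ ‖p.2‖ < ε} :=
    (measurableSet_le measurable_fst.norm measurable_snd.norm).inter
      (measurableSet_lt measurable_snd.norm measurable_const)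
  have hmeas : Measurable fun p : ℂ × ℂ => ENNReal.ofReal (‖evalFun f p‖ ^ (-2 * c)) :=
    ((continuous_evalFun f).measurable.norm.pow_const _).ennreal_ofReal
  rw [← lintegral_indicator hS, Measure.volume_eq_prod,
    lintegral_prod_symm' _ (hmeas.indicator hS)]
  have hle : ∀ᵐ y : ℂ, ∫⁻ x : ℂ, ({p : ℂ × ℂ | ‖p.1‖ ≤ ‖p.2‖ ∧ ‖p.2‖ < ε}.indicator
      (fun p => ENNReal.ofReal (‖evalFun f p‖ ^ (-2 * c)))) (x, y) ≤
      (Metric.ball (0 : ℂ) ε).indicator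
        (fun y => ENNReal.ofReal (K * ‖y‖ ^ (-(2 * c * n - 2)))) y := by
    filter_upwards [compl_mem_ae_iff.2 (measure_singleton (0 : ℂ))] with y hy
    by_cases hyε : ‖y‖ < ε
    · rw [Set.indicator_of_mem (by simpa using hyε)]
      refine le_trans (le_of_eq ?_) (hK y hy hyε)
      rw [← lintegral_indicator measurableSet_closedBall]
      refine lintegral_congr fun x => ?_
      by_cases hxy : ‖x‖ ≤ ‖y‖ <;> simp [hxy, hyε]
    · simp [hyε]
  refine (lintegral_mono_ae hle).trans_lt ?_
  rw [lintegral_indicator measurableSet_ball]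
  have hint : IntegrableOn (fun y : ℂ => K * ‖y‖ ^ (-(2 * c * n - 2))) (Metric.ball 0 ε) :=
    (integrableOn_ball_of_norm_le_rpow (C := 1) (α := 2 * c * n - 2)
      (by simp [Complex.finrank_real_complex])
      (by rw [Complex.finrank_real_complex]; push_cast; linarith)
      (Filter.Eventually.of_forall fun x => by
        rw [one_mul, Real.norm_of_nonneg (by positivity)])
      (measurable_norm.pow_const _).aestronglyMeasurable).const_mul K
  exact hint.lintegral_lt_top

theorem exists_integrableOn_ball_evalFun {f : MvPolynomial (Fin 2) ℂ} {n N : ℕ}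
    (hf : ∀ e ∈ f.support, n ≤ e 0 + e 1)
    (h : ∀ s : ℂ, ∃ m ≤ N, (Polynomial.taylor s (chartPoly f n 0)).coeff m ≠ 0)
    (h' : ∀ s : ℂ, ∃ m ≤ N,
      (Polynomial.taylor s (chartPoly (rename (Equiv.swap 0 1) f) n 0)).coeff m ≠ 0)
    {c : ℝ} (hc : 0 < c) (hcN : c * N < 1) (hcn : c * n < 2) :
    ∃ ε > (0 : ℝ), IntegrableOn (fun p => ‖evalFun f p‖ ^ (-2 * c)) (Metric.ball 0 ε) := by
  set g := rename (Equiv.swap 0 1) f with hgdef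
  have hg : ∀ e ∈ g.support, n ≤ e 0 + e 1 := by
    intro e he
    obtain ⟨u, rfl, hu⟩ := coeff_rename_ne_zero _ _ _ (mem_support_iff.1 he)
    have := hf u (mem_support_iff.2 hu)
    rw [← Fin.sum_univ_two (f := fun i => u i), ← Finsupp.degree_eq_sum] at this
    rw [← Fin.sum_univ_two (f := fun i => (Finsupp.mapDomain (Equiv.swap 0 1) u) i),
      ← Finsupp.degree_eq_sum, Finsupp.degree_mapDomain]
    exact this
  obtain ⟨ε₁, hε₁, h₁⟩ := exists_lintegral_chart_evalFun_lt_top hf h hc hcN hcn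
  obtain ⟨ε₂, hε₂, h₂⟩ := exists_lintegral_chart_evalFun_lt_top hg h' hc hcN hcn
  have hswap : ∀ p : ℂ × ℂ, evalFun g p = evalFun f p.swap := by
    rintro ⟨x, y⟩
    simp only [evalFun, hgdef, eval_rename]
    congr 2
    ext i
    fin_cases i <;> simp
  have hmeas : Measurable fun p : ℂ × ℂ => ‖evalFun f p‖ ^ (-2 * c) :=
    (continuous_evalFun f).measurable.norm.pow_const _
  have h₃ : ∫⁻ p in {p : ℂ × ℂ | ‖p.2‖ ≤ ‖p.1‖ ∧ ‖p.1‖ < ε₂},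
      ENNReal.ofReal (‖evalFun f p‖ ^ (-2 * c)) < ⊤ := by
    have hmp : MeasurePreserving (Prod.swap : ℂ × ℂ → ℂ × ℂ) volume volume :=
      Measure.measurePreserving_swap
    have := hmp.setLIntegral_comp_preimage_emb MeasurableEquiv.prodComm.measurableEmbedding
      (fun p => ENNReal.ofReal (‖evalFun f p‖ ^ (-2 * c)))
      {p : ℂ × ℂ | ‖p.2‖ ≤ ‖p.1‖ ∧ ‖p.1‖ < ε₂}
    rw [← this]
    simp only [hswap] at h₂
    exact h₂
  refine ⟨min ε₁ ε₂, lt_min hε₁ hε₂, hmeas.aestronglyMeasurable, ?_⟩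
  rw [hasFiniteIntegral_iff_ofReal (Filter.Eventually.of_forall fun p => by positivity)]
  have hsub : Metric.ball (0 : ℂ × ℂ) (min ε₁ ε₂) ⊆ {p : ℂ × ℂ | ‖p.1‖ ≤ ‖p.2‖ ∧ ‖p.2‖ < ε₁} ∪
      {p : ℂ × ℂ | ‖p.2‖ ≤ ‖p.1‖ ∧ ‖p.1‖ < ε₂} := by
    intro p hp
    rw [mem_ball_zero_iff, lt_min_iff, Prod.norm_def, max_lt_iff, max_lt_iff] at hp
    rcases le_total ‖p.1‖ ‖p.2‖ with hle | hle
    · exact Or.inl ⟨hle, hp.1.2⟩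
    · exact Or.inr ⟨hle, hp.2.1⟩
  calc _ ≤ _ := lintegral_mono_set hsub
    _ ≤ _ := lintegral_union_le _ _ _
    _ < ⊤ := ENNReal.add_lt_top.2 ⟨h₁, h₃⟩

theorem isHomogeneous_X_sub_C_mul_X (s : ℂ) :
    (X 0 - C s * X 1 : MvPolynomial (Fin 2) ℂ).IsHomogeneous 1 :=
  (isHomogeneous_X _ _).sub (isHomogeneous_C_mul_X _ _)

theorem X_sub_C_mul_X_ne_zero (s : ℂ) : (X 0 - C s * X 1 : MvPolynomial (Fin 2) ℂ) ≠ 0 := by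
  intro h
  have := congrArg (eval ![1, 0]) h
  simp at this

theorem pow_X_sub_C_mul_X_dvd {n M : ℕ} {F : MvPolynomial (Fin 2) ℂ} (hF : F.IsHomogeneous n)
    (hF0 : F ≠ 0) {s : ℂ}
    (h : (Polynomial.X - Polynomial.C s) ^ M ∣ aeval ![Polynomial.X, 1] F) :
    (X 0 - C s * X 1) ^ M ∣ F := by
  set p : Polynomial ℂ := aeval ![Polynomial.X, 1] F with hp
  have hpF : p.homogenize n = F := Polynomial.homogenize_eq_of_isHomogeneous hF rfl
  have hp0 : p ≠ 0 := by
    intro h0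
    rw [h0, Polynomial.homogenize_zero] at hpF
    exact hF0 hpF.symm
  have hdeg : p.natDegree ≤ n := by
    have hc := chartPoly_zero (f := F) (n := n) fun e he => by
      rw [← Fin.sum_univ_two (f := fun i => e i), ← Finsupp.degree_eq_sum,
        hF.degree_eq_sum_deg_support he]
      rfl
    rw [homogeneousComponent_eq_self hF] at hc
    rw [hp, ← hc]
    exact (natDegree_chartPoly_le F n 0).trans hF.totalDegree_le
  obtain ⟨q, hq⟩ := h
  have hq0 : q ≠ 0 := by rintro rfl; simp [hp0] at hq
  have hadd : M + q.natDegree ≤ n := by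
    have := congrArg Polynomial.natDegree hq
    rw [Polynomial.natDegree_mul (pow_ne_zero _ (Polynomial.X_sub_C_ne_zero s)) hq0,
      Polynomial.natDegree_pow, Polynomial.natDegree_X_sub_C, mul_one] at this
    omega
  have key : p.homogenize n = (X 0 - C s * X 1) ^ M * q.homogenize (n - M) := by
    refine Polynomial.homogenize_eq_of_isHomogeneous ?_ ?_
    · have := ((isHomogeneous_X_sub_C_mul_X s).pow M).mul
        (Polynomial.isHomogeneous_homogenize (n := n - M) q)
      rwa [one_mul, Nat.add_sub_cancel' (by omega)] at this
    · rw [hq, map_mul, Polynomial.aeval_homogenize_X_one q (by omega)]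
      simp [Polynomial.C_eq_algebraMap]
  rw [← hpF, key]
  exact dvd_mul_right _ _

theorem exists_taylor_coeff_ne_zero {n N : ℕ} {F : MvPolynomial (Fin 2) ℂ}
    (hF : F.IsHomogeneous n) (hF0 : F ≠ 0)
    (h : ¬ ∃ (ℓ : MvPolynomial (Fin 2) ℂ) (m : ℕ), ℓ ≠ 0 ∧ ℓ.IsHomogeneous 1 ∧ N < m ∧ ℓ ^ m ∣ F)
    (s : ℂ) :
    ∃ m ≤ N, (Polynomial.taylor s (aeval ![Polynomial.X, 1] F)).coeff m ≠ 0 := by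
  by_contra! hcon
  refine h ⟨_, N + 1, X_sub_C_mul_X_ne_zero s, isHomogeneous_X_sub_C_mul_X s, N.lt_succ_self,
    pow_X_sub_C_mul_X_dvd hF hF0 ?_⟩
  rw [Polynomial.X_sub_C_pow_dvd_iff, Polynomial.X_pow_dvd_iff]
  exact fun m hm => hcon m (Nat.lt_succ_iff.1 hm)

theorem ae_evalFun_ne_zero {f : MvPolynomial (Fin 2) ℂ} (hf : f ≠ 0) :
    ∀ᵐ p : ℂ × ℂ, evalFun f p ≠ 0 := by
  obtain ⟨v, hv⟩ : ∃ v : Fin 2 → ℂ, eval v f ≠ 0 := by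
    by_contra! h
    exact hf (funext fun v => by rw [h v, map_zero])
  set row : ℂ → Polynomial ℂ := fun x => aeval ![Polynomial.C x, Polynomial.X] f with hrow
  set col : Polynomial ℂ := aeval ![Polynomial.X, Polynomial.C (v 1)] f with hcol
  have hrow_eval : ∀ x y, (row x).eval y = evalFun f (x, y) := fun x y => by
    simp only [hrow]
    rw [← Polynomial.coe_evalRingHom, evalFun, aeval_def, ← coe_eval₂Hom,
      ← RingHom.comp_apply]
    congr 1
    ext i
    · simp
    · fin_cases i <;> simp
  have hcol_eval : ∀ x, col.eval x = evalFun f (x, v 1) := fun x => by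
    rw [hcol, ← Polynomial.coe_evalRingHom, evalFun, aeval_def, ← coe_eval₂Hom,
      ← RingHom.comp_apply]
    congr 1
    ext i
    · simp
    · fin_cases i <;> simp
  have hcol0 : col ≠ 0 := by
    intro h0
    have := hcol_eval (v 0)
    rw [h0, Polynomial.eval_zero, evalFun] at this
    refine hv ?_
    rw [this]
    congr 2
    ext i
    fin_cases i <;> rfl
  have hnull : ∀ P : Polynomial ℂ, P ≠ 0 → ∀ᵐ x : ℂ, P.eval x ≠ 0 := fun P hP => by
    refine measure_mono_null ?_ (P.roots.toFinset.finite_toSet.measure_zero volume)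
    intro x hx
    simpa [hP] using hx
  have hmeas : MeasurableSet {p : ℂ × ℂ | evalFun f p ≠ 0} :=
    ((continuous_evalFun f).measurable (measurableSet_singleton 0)).compl
  rw [Measure.volume_eq_prod, Measure.ae_prod_iff_ae_ae hmeas]
  filter_upwards [hnull col hcol0] with x hx
  have : row x ≠ 0 := by
    intro h0
    rw [hcol_eval, ← hrow_eval, h0, Polynomial.eval_zero] at hx
    exact hx rfl
  filter_upwards [hnull _ this] with y hy
  rwa [← hrow_eval]

theorem mul_le_of_integrableOn_of_norm_le {F : ℂ × ℂ → ℂ} (hF : ∀ᵐ p, F p ≠ 0)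
    {T : ℂ × ℂ →ₗ[ℝ] ℂ × ℂ} (hT : Function.Injective T) {C D w c ε : ℝ} (hw : 1 ≤ w) (hC : 0 < C)
    (hbd : ∀ t : ℝ, 0 < t → t < 1 → ∀ u v : ℂ, ‖u‖ < t → ‖v‖ < t ^ w → ‖F (T (u, v))‖ ≤ C * t ^ D)
    (hc : 0 ≤ c) (hε : 0 < ε)
    (hint : IntegrableOn (fun p => ‖F p‖ ^ (-2 * c)) (Metric.ball 0 ε)) :
    c * D ≤ 1 + w := by
  by_contra! hcon
  have hdet : T.det ≠ 0 := fun h0 => by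
    have := LinearMap.bot_lt_ker_of_det_eq_zero h0
    rw [LinearMap.ker_eq_bot.2 hT] at this
    exact this.false
  set I := ∫⁻ p in Metric.ball 0 ε, ENNReal.ofReal (‖F p‖ ^ (-2 * c)) with hI
  have hIfin : I ≠ ⊤ := hint.lintegral_lt_top.ne
  set A := ‖T.toContinuousLinearMap‖ with hA
  have key : ∀ t : ℝ, 0 < t → t < 1 → t < ε / (A + 1) →
      (C ^ (-2 * c) * (|T.det| * Real.pi ^ 2)) * t ^ (-(2 * (c * D - (1 + w)))) ≤ I.toReal := by
    intro t ht ht1 htε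
    have htw : t ^ w ≤ t := by
      simpa using Real.rpow_le_rpow_of_exponent_ge ht ht1.le hw
    have htw0 : 0 < t ^ w := by positivity
    set S := T '' (Metric.ball 0 t ×ˢ Metric.ball 0 (t ^ w)) with hS
    have hSm : MeasurableSet S :=
      (measurableSet_ball.prod measurableSet_ball).image_of_continuousOn_injOn
        (LinearMap.continuous_of_finiteDimensional T).continuousOn hT.injOn
    have hsub : S ⊆ Metric.ball 0 ε := by
      rintro _ ⟨⟨u, v⟩, ⟨hu, hv⟩, rfl⟩
      rw [mem_ball_zero_iff] at *
      have hle : ‖(u, v)‖ ≤ t := max_le hu.le (hv.le.trans htw)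
      have := T.toContinuousLinearMap.le_opNorm (u, v)
      rw [lt_div_iff₀ (by positivity)] at htε
      calc _ ≤ A * ‖(u, v)‖ := this
        _ ≤ A * t := by gcongr
        _ < ε := by nlinarith
    have hvol : volume S = ENNReal.ofReal (|T.det| * Real.pi ^ 2 * (t ^ 2 * (t ^ w) ^ 2)) := by
      rw [hS, Measure.volume_eq_prod, Measure.addHaar_image_linearMap, Measure.prod_prod,
        Complex.volume_ball, Complex.volume_ball, ← NNReal.coe_real_pi,
        ENNReal.ofReal_mul (by positivity), ENNReal.ofReal_mul (abs_nonneg _),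
        ENNReal.ofReal_mul (by positivity), ENNReal.ofReal_pow (by positivity),
        ENNReal.ofReal_pow ht.le, ENNReal.ofReal_pow htw0.le, ENNReal.ofReal_coe_nnreal]
      ring
    have hle : ENNReal.ofReal ((C * t ^ D) ^ (-2 * c)) * volume S ≤ I := by
      rw [← setLIntegral_const]
      calc _ ≤ ∫⁻ p in S, ENNReal.ofReal (‖F p‖ ^ (-2 * c)) := by
            refine setLIntegral_mono_ae' hSm ?_
            filter_upwards [hF] with p hp
            rintro ⟨⟨u, v⟩, ⟨hu, hv⟩, rfl⟩
            refine ENNReal.ofReal_le_ofReal (Real.rpow_le_rpow_of_nonpos (norm_pos_iff.2 hp)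
              (hbd t ht ht1 u v (by simpa using hu) (by simpa using hv)) (by linarith))
        _ ≤ I := lintegral_mono_set hsub
    rw [hvol, ← ENNReal.ofReal_mul (by positivity), ENNReal.ofReal_le_iff_le_toReal hIfin] at hle
    refine le_trans (le_of_eq ?_) hle
    have e : t ^ (-(2 * (c * D - (1 + w)))) = (t ^ D) ^ (-2 * c) * (t ^ 2 * (t ^ w) ^ 2) := by
      rw [← Real.rpow_two, ← Real.rpow_two, ← Real.rpow_mul ht.le, ← Real.rpow_mul ht.le,
        ← Real.rpow_add ht, ← Real.rpow_add ht]
      congr 1; ring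
    rw [e, Real.mul_rpow hC.le (by positivity)]
    ring
  set κ := C ^ (-2 * c) * (|T.det| * Real.pi ^ 2) with hκ
  have hκ0 : 0 < κ := by have := abs_pos.2 hdet; positivity
  have hlim : Filter.Tendsto (fun t : ℝ => κ * t ^ (-(2 * (c * D - (1 + w)))))
      (nhdsWithin 0 (Set.Ioi 0)) Filter.atTop :=
    (tendsto_rpow_neg_nhdsGT_zero (by linarith)).const_mul_atTop hκ0
  have hev : ∀ᶠ t : ℝ in nhdsWithin 0 (Set.Ioi 0), 0 < t ∧ t < min 1 (ε / (A + 1)) :=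
    Ioo_mem_nhdsGT (by positivity)
  obtain ⟨t, h1, h2, h3⟩ := ((hlim.eventually_gt_atTop I.toReal).and hev).exists
  exact absurd (key t h2 (h3.trans_le (min_le_left _ _)) (h3.trans_le (min_le_right _ _)))
    (not_le.2 h1)

theorem exists_norm_evalFun_le {f : MvPolynomial (Fin 2) ℂ} {k : ℕ}
    (hf : ∀ e ∈ f.support, k ≤ e 0 + e 1) {A : ℝ} (hA : 0 ≤ A) :
    ∃ C > (0 : ℝ), ∀ (p : ℂ × ℂ) (t : ℝ), 0 < t → t ≤ 1 → ‖p‖ ≤ A * t →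
      ‖evalFun f p‖ ≤ C * t ^ k := by
  have hnn : 0 ≤ ∑ e ∈ f.support, ‖coeff e f‖ * A ^ (e 0 + e 1) :=
    Finset.sum_nonneg fun e _ => by positivity
  refine ⟨(∑ e ∈ f.support, ‖coeff e f‖ * A ^ (e 0 + e 1)) + 1, by positivity,
    fun p t ht ht1 hp => ?_⟩
  have h1 : ‖p.1‖ ≤ A * t := (norm_fst_le p).trans hp
  have h2 : ‖p.2‖ ≤ A * t := (norm_snd_le p).trans hp
  rw [evalFun_eq_sum]
  calc _ ≤ ∑ e ∈ f.support, ‖coeff e f * (p.1 ^ e 0 * p.2 ^ e 1)‖ := norm_sum_le _ _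
    _ ≤ ∑ e ∈ f.support, ‖coeff e f‖ * A ^ (e 0 + e 1) * t ^ k := by
        refine Finset.sum_le_sum fun e he => ?_
        rw [norm_mul, norm_mul, norm_pow, norm_pow, mul_assoc]
        refine mul_le_mul_of_nonneg_left ?_ (norm_nonneg _)
        calc _ ≤ (A * t) ^ e 0 * (A * t) ^ e 1 := by gcongr
          _ = A ^ (e 0 + e 1) * t ^ (e 0 + e 1) := by rw [← pow_add, mul_pow]
          _ ≤ _ := mul_le_mul_of_nonneg_left (pow_le_pow_of_le_one ht.le ht1 (hf e he))
            (by positivity)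
    _ ≤ _ := by
        rw [← Finset.sum_mul]
        gcongr
        linarith

theorem le_of_mem_support_of_homogeneousComponent_eq_zero {f : MvPolynomial (Fin 2) ℂ} {k : ℕ}
    (hf : ∀ i < k, homogeneousComponent i f = 0) : ∀ e ∈ f.support, k ≤ e 0 + e 1 := by
  intro e he
  by_contra! hlt
  have h := congrArg (coeff e) (hf _ hlt)
  have hdeg : e.degree = e 0 + e 1 := by rw [Finsupp.degree_eq_sum, Fin.sum_univ_two]
  rw [coeff_homogeneousComponent, if_pos hdeg, coeff_zero] at h
  exact mem_support_iff.1 he h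

theorem exists_isHomogeneous_eq_mul {n k : ℕ} {F a : MvPolynomial (Fin 2) ℂ}
    (hF : F.IsHomogeneous n) (hF0 : F ≠ 0) (ha : a.IsHomogeneous k) (h : a ∣ F) :
    ∃ (j : ℕ) (g : MvPolynomial (Fin 2) ℂ), k + j = n ∧ g.IsHomogeneous j ∧ F = a * g := by
  obtain ⟨g, rfl⟩ := h
  have hsum : a * g = ∑ i ∈ Finset.range (g.totalDegree + 1),
      homogeneousComponent n (a * homogeneousComponent i g) := by
    conv_lhs => rw [← homogeneousComponent_eq_self hF, ← sum_homogeneousComponent g]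
    rw [Finset.mul_sum, map_sum]
  obtain ⟨i, -, hi⟩ := Finset.exists_ne_zero_of_sum_ne_zero (hsum ▸ hF0)
  have hcomp : ∀ j, homogeneousComponent n (a * homogeneousComponent j g) =
      if n = k + j then a * homogeneousComponent j g else 0 := fun j => by
    rw [homogeneousComponent_of_mem (ha.mul (homogeneousComponent_isHomogeneous j g))]
  have hin : n = k + i := by
    by_contra hne
    rw [hcomp, if_neg hne] at hi
    exact hi rfl
  refine ⟨i, homogeneousComponent i g, hin.symm, homogeneousComponent_isHomogeneous i g, ?_⟩
  rw [hsum, Finset.sum_eq_single i]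
  · rw [hcomp, if_pos hin]
  · intro j _ hj
    rw [hcomp, if_neg (by omega)]
  · intro hni
    rw [homogeneousComponent_eq_zero i g (by simpa using hni), mul_zero, map_zero]

theorem exists_eq_add_of_isHomogeneous_one {ℓ : MvPolynomial (Fin 2) ℂ}
    (hℓ : ℓ.IsHomogeneous 1) : ∃ α β : ℂ, ℓ = C α * X 0 + C β * X 1 := by
  have h : ℓ ∈ homogeneousSubmodule (Fin 2) ℂ 1 := hℓ
  rw [homogeneousSubmodule_one_eq_span_X, Submodule.mem_span_range_iff_exists_fun] at h
  obtain ⟨c, hc⟩ := h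
  refine ⟨c 0, c 1, ?_⟩
  rw [← hc, Fin.sum_univ_two, smul_eq_C_mul, smul_eq_C_mul]

theorem exists_linearMap_norm_evalFun_eq {ℓ : MvPolynomial (Fin 2) ℂ} (hℓ0 : ℓ ≠ 0)
    (hℓ : ℓ.IsHomogeneous 1) : ∃ (T : ℂ × ℂ →ₗ[ℝ] ℂ × ℂ) (M : ℝ), Function.Injective T ∧ 0 < M ∧
      ∀ p : ℂ × ℂ, ‖evalFun ℓ (T p)‖ = M * ‖p.2‖ := by
  obtain ⟨α, β, rfl⟩ := exists_eq_add_of_isHomogeneous_one hℓ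
  have hM : 0 < Complex.normSq α + Complex.normSq β := by
    by_contra! hle
    have hα : α = 0 := Complex.normSq_eq_zero.1
      (by linarith [Complex.normSq_nonneg α, Complex.normSq_nonneg β])
    have hβ : β = 0 := Complex.normSq_eq_zero.1
      (by linarith [Complex.normSq_nonneg α, Complex.normSq_nonneg β])
    simp [hα, hβ] at hℓ0
  let T : ℂ × ℂ →ₗ[ℝ] ℂ × ℂ :=
    { toFun := fun p => ((starRingEnd ℂ) α * p.2 - β * p.1, α * p.1 + (starRingEnd ℂ) β * p.2)
      map_add' := fun p q => by ext <;> simp <;> ring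
      map_smul' := fun r p => by ext <;> simp <;> ring }
  have hT : ∀ p, T p =
      ((starRingEnd ℂ) α * p.2 - β * p.1, α * p.1 + (starRingEnd ℂ) β * p.2) := fun p => rfl
  have hval : ∀ p, evalFun (C α * X 0 + C β * X 1) (T p) =
      ((Complex.normSq α + Complex.normSq β : ℝ) : ℂ) * p.2 := fun p => by
    simp only [evalFun, hT, map_add, map_mul, eval_C, eval_X, Matrix.cons_val_zero,
      Matrix.cons_val_one, Complex.ofReal_add, ← Complex.mul_conj]
    ring
  refine ⟨T, Complex.normSq α + Complex.normSq β, ?_, hM, fun p => ?_⟩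
  · rw [injective_iff_map_eq_zero]
    intro p hp
    have h2 : p.2 = 0 := by
      have := hval p
      rw [hp] at this
      have hM' : ((Complex.normSq α + Complex.normSq β : ℝ) : ℂ) ≠ 0 := by
        exact_mod_cast hM.ne'
      refine (mul_eq_zero.1 (this.symm.trans ?_)).resolve_left hM'
      simp [evalFun]
    rw [hT, h2, Prod.mk_eq_zero] at hp
    have h1 : p.1 = 0 := by
      by_contra hne
      have hβ : β = 0 := by simpa [hne] using hp.1
      have hα : α = 0 := by simpa [hne] using hp.2
      simp [hα, hβ] at hM
    exact Prod.ext h1 h2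
  · rw [hval, norm_mul, Complex.norm_real, Real.norm_of_nonneg hM.le]

theorem mul_le_two_of_integrableOn {f : MvPolynomial (Fin 2) ℂ} (hf0 : f ≠ 0) {n : ℕ}
    (hf : ∀ e ∈ f.support, n ≤ e 0 + e 1) {c ε : ℝ} (hc : 0 ≤ c) (hε : 0 < ε)
    (hint : IntegrableOn (fun p => ‖evalFun f p‖ ^ (-2 * c)) (Metric.ball 0 ε)) : c * n ≤ 2 := by
  obtain ⟨C, hC, hbd⟩ := exists_norm_evalFun_le hf zero_le_one
  have := mul_le_of_integrableOn_of_norm_le (T := LinearMap.id) (D := n) (w := 1)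
    (ae_evalFun_ne_zero hf0) Function.injective_id le_rfl hC (fun t ht ht1 u v hu hv => by
      rw [Real.rpow_natCast]
      rw [Real.rpow_one] at hv
      refine hbd _ t ht ht1.le ?_
      rw [one_mul]
      exact max_le hu.le hv.le) hc hε hint
  linarith

theorem mul_le_of_pow_dvd_homogeneousComponent {f : MvPolynomial (Fin 2) ℂ} {n m : ℕ}
    (hlow : ∀ i < n, homogeneousComponent i f = 0) (htop : homogeneousComponent n f ≠ 0)
    {ℓ : MvPolynomial (Fin 2) ℂ} (hℓ0 : ℓ ≠ 0) (hℓ : ℓ.IsHomogeneous 1) (hm : 0 < m)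
    (hdvd : ℓ ^ m ∣ homogeneousComponent n f) {c ε : ℝ} (hc : 0 ≤ c) (hε : 0 < ε)
    (hint : IntegrableOn (fun p => ‖evalFun f p‖ ^ (-2 * c)) (Metric.ball 0 ε)) :
    c * (n + 1) ≤ 2 + 1 / m := by
  have hf0 : f ≠ 0 := by rintro rfl; simp at htop
  obtain ⟨T, M, hT, hM, hTℓ⟩ := exists_linearMap_norm_evalFun_eq hℓ0 hℓ
  set A := ‖T.toContinuousLinearMap‖ with hA
  obtain ⟨j, g, hjn, hg, hfac⟩ := exists_isHomogeneous_eq_mul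
    (homogeneousComponent_isHomogeneous n f) htop (by simpa using hℓ.pow m) hdvd
  have hgs : ∀ e ∈ g.support, j ≤ e 0 + e 1 := by
    refine le_of_mem_support_of_homogeneousComponent_eq_zero fun i hi => ?_
    rw [homogeneousComponent_of_mem hg, if_neg hi.ne]
  have hrs : ∀ e ∈ (f - homogeneousComponent n f).support, n + 1 ≤ e 0 + e 1 := by
    refine le_of_mem_support_of_homogeneousComponent_eq_zero fun i hi => ?_
    rw [map_sub, homogeneousComponent_of_mem (homogeneousComponent_isHomogeneous n f)]
    rcases Nat.lt_succ_iff_lt_or_eq.1 hi with h | rfl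
    · rw [hlow i h, if_neg h.ne, sub_zero]
    · rw [if_pos rfl, sub_self]
  obtain ⟨C₁, hC₁, hb₁⟩ := exists_norm_evalFun_le hgs (norm_nonneg T.toContinuousLinearMap)
  obtain ⟨C₂, hC₂, hb₂⟩ := exists_norm_evalFun_le hrs (norm_nonneg T.toContinuousLinearMap)
  have hm' : (0 : ℝ) < m := by exact_mod_cast hm
  have hw : (1 : ℝ) ≤ 1 + 1 / m := by
    have : 0 < 1 / (m : ℝ) := by positivity
    linarith
  have := mul_le_of_integrableOn_of_norm_le (T := T) (D := (n + 1 : ℕ)) (w := 1 + 1 / m)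
    (C := M ^ m * C₁ + C₂) (ae_evalFun_ne_zero hf0) hT hw
    (by positivity) (fun t ht ht1 u v hu hv => by
      rw [Real.rpow_natCast]
      have htw : t ^ (1 + 1 / (m : ℝ)) ≤ t := by
        have := Real.rpow_le_rpow_of_exponent_ge ht ht1.le hw
        simpa using this
      have htm : (t ^ (1 + 1 / (m : ℝ))) ^ m = t ^ (m + 1) := by
        rw [← Real.rpow_natCast, ← Real.rpow_mul ht.le, ← Real.rpow_natCast]
        congr 1
        push_cast
        field_simp
      have hTp : ‖T (u, v)‖ ≤ A * t := by
        refine (T.toContinuousLinearMap.le_opNorm (u, v)).trans ?_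
        gcongr
        exact max_le hu.le (hv.le.trans htw)
      have hsplit : evalFun f (T (u, v)) = evalFun ℓ (T (u, v)) ^ m * evalFun g (T (u, v)) +
          evalFun (f - homogeneousComponent n f) (T (u, v)) := by
        simp only [evalFun]
        rw [map_sub, hfac, map_mul, map_pow]
        ring
      rw [hsplit]
      calc _ ≤ ‖evalFun ℓ (T (u, v))‖ ^ m * ‖evalFun g (T (u, v))‖ +
            ‖evalFun (f - homogeneousComponent n f) (T (u, v))‖ := by
            rw [← norm_pow, ← norm_mul]
            exact norm_add_le _ _
        _ ≤ (M * t ^ (1 + 1 / (m : ℝ))) ^ m * (C₁ * t ^ j) + C₂ * t ^ (n + 1) := by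
            gcongr
            · rw [hTℓ]
              gcongr
            · exact hb₁ _ t ht ht1.le hTp
            · exact hb₂ _ t ht ht1.le hTp
        _ = _ := by
            rw [mul_pow, htm, ← hjn]
            ring) hc hε hint
  push_cast at this
  linarith

theorem exists_integrableOn_of_forall_not_pow_dvd {f : MvPolynomial (Fin 2) ℂ} {n N : ℕ}
    (hlow : ∀ i < n, homogeneousComponent i f = 0) (htop : homogeneousComponent n f ≠ 0)
    (h : ¬ ∃ (ℓ : MvPolynomial (Fin 2) ℂ) (m : ℕ), ℓ ≠ 0 ∧ ℓ.IsHomogeneous 1 ∧ N < m ∧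
      ℓ ^ m ∣ homogeneousComponent n f)
    {c : ℝ} (hc : 0 < c) (hcN : c * N < 1) (hcn : c * n < 2) :
    ∃ ε > (0 : ℝ), IntegrableOn (fun p => ‖evalFun f p‖ ^ (-2 * c)) (Metric.ball 0 ε) := by
  have hf := le_of_mem_support_of_homogeneousComponent_eq_zero hlow
  have hinj : Function.Injective (rename (Equiv.swap 0 1) :
      MvPolynomial (Fin 2) ℂ → MvPolynomial (Fin 2) ℂ) :=
    rename_injective _ (Equiv.injective _)
  have hinv : ∀ q : MvPolynomial (Fin 2) ℂ,
      rename (Equiv.swap 0 1) (rename (Equiv.swap 0 1) q) = q := fun q => by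
    rw [rename_rename, ← Equiv.coe_trans, Equiv.swap_swap, Equiv.coe_refl, rename_id_apply]
  have hg := le_of_mem_support_of_homogeneousComponent_eq_zero (k := n)
    (f := rename (Equiv.swap 0 1) f) fun i hi => by
      rw [← rename_homogeneousComponent, hlow i hi, map_zero]
  refine exists_integrableOn_ball_evalFun (N := N) hf (fun s => ?_) (fun s => ?_) hc hcN hcn
  · rw [chartPoly_zero hf]
    exact exists_taylor_coeff_ne_zero (homogeneousComponent_isHomogeneous n f) htop h s
  · rw [chartPoly_zero hg]
    refine exists_taylor_coeff_ne_zero (homogeneousComponent_isHomogeneous n _) ?_ ?_ s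
    · rw [← rename_homogeneousComponent]
      exact fun h0 => htop (hinj (h0.trans (map_zero _).symm))
    · rintro ⟨ℓ, m, hℓ0, hℓ, hm, hdvd⟩
      refine h ⟨rename (Equiv.swap 0 1) ℓ, m, fun h0 => hℓ0 (hinj (h0.trans (map_zero _).symm)),
        hℓ.rename_isHomogeneous, hm, ?_⟩
      have := map_dvd (rename (Equiv.swap 0 1) :
        MvPolynomial (Fin 2) ℂ →ₐ[ℂ] MvPolynomial (Fin 2) ℂ) hdvd
      rwa [rename_homogeneousComponent, hinv, map_pow] at this

theorem lct_lt_iff_high_mult_linear_factor (d : ℕ) (hd : 3 ≤ d)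
    (f : MvPolynomial (Fin 2) ℂ) (hsf : Squarefree f)
    (hdeg : f.totalDegree = d)
    (hlow : ∀ i < d - 1, homogeneousComponent i f = 0)
    (htop : homogeneousComponent (d - 1) f ≠ 0) :
    lct₀ (evalFun f) < 2 / (d - 1) ↔
      ∃ (ℓ : MvPolynomial (Fin 2) ℂ) (m : ℕ), ℓ ≠ 0 ∧ ℓ.IsHomogeneous 1 ∧
        2 * m > d - 1 ∧ ℓ ^ m ∣ homogeneousComponent (d - 1) f := by
  obtain ⟨n, rfl⟩ : ∃ n, d = n + 1 := ⟨d - 1, by omega⟩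
  simp only [Nat.add_sub_cancel] at hlow htop ⊢
  have hn : (2 : ℝ) ≤ n := by exact_mod_cast (by omega : 2 ≤ n)
  have hn0 : (0 : ℝ) < n := by linarith
  have hcast : ((n + 1 : ℕ) : ℝ) - 1 = n := by push_cast; ring
  rw [hcast]
  have hf := le_of_mem_support_of_homogeneousComponent_eq_zero hlow
  constructor
  · intro hlt
    by_contra hcon
    refine not_le.2 hlt (le_of_forall_lt fun b hb => ?_)
    have hpos : 0 < 2 / (n : ℝ) := by positivity
    set c : ℝ := (max b 0 + 2 / n) / 2 with hc
    have hmax : max b 0 < 2 / n := max_lt hb hpos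
    have hc0 : 0 < c := by have := le_max_right b 0; rw [hc]; linarith
    have hbc : b < c := by have := le_max_left b 0; rw [hc]; linarith
    have hcn : c * n < 2 := by
      rw [← lt_div_iff₀ hn0, hc]
      linarith
    have hN : ((n / 2 : ℕ) : ℝ) ≤ n / 2 := Nat.cast_div_le
    have hcN : c * (n / 2 : ℕ) < 1 := by nlinarith
    obtain ⟨ε, hε, hint⟩ := exists_integrableOn_of_forall_not_pow_dvd hlow htop
      (N := n / 2) (by
        rintro ⟨ℓ, m, hℓ0, hℓ, hm, hdvd⟩
        exact hcon ⟨ℓ, m, hℓ0, hℓ, by omega, hdvd⟩) hc0 hcN hcn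
    refine hbc.trans_le (le_csSup ⟨2 / n, ?_⟩ ⟨hc0.le, ε, hε, hint⟩)
    rintro c' ⟨hc', ε', hε', hint'⟩
    rw [le_div_iff₀ hn0]
    exact mul_le_two_of_integrableOn hsf.ne_zero hf hc' hε' hint'
  · rintro ⟨ℓ, m, hℓ0, hℓ, hm, hdvd⟩
    have hm0 : 0 < m := by omega
    have hm0' : (0 : ℝ) < m := by exact_mod_cast hm0
    have hle : lct₀ (evalFun f) ≤ (2 + 1 / m) / (n + 1) := by
      refine csSup_le ⟨0, le_rfl, 1, one_pos, ?_⟩ ?_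
      · simp [measure_ball_lt_top]
      · rintro c ⟨hc, ε, hε, hint⟩
        rw [le_div_iff₀ (by positivity)]
        exact mul_le_of_pow_dvd_homogeneousComponent hlow htop hℓ0 hℓ hm0 hdvd hc hε hint
    refine hle.trans_lt ?_
    have hm' : (n : ℝ) < 2 * m := by exact_mod_cast hm
    rw [div_lt_div_iff₀ (by positivity) hn0]
    have : 1 / (m : ℝ) * n < 2 := by
      rw [one_div_mul_eq_div, div_lt_iff₀ hm0']
      exact hm'
    nlinarith
end
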